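/- For every blind MDP Γ and every initial belief p₁ ∈ Δ(K), the value equals the supremum of the payoff over eventually periodic strategies: v_∞(p₁) = sup{γ^{p₁}_∞(σ) : σ ∈ A^ℕ eventually periodic}. -/

import Mathlib

open MeasureTheory Filter

namespace PomdpPaper

/-- A belief (probability vector) on `Fin n`. -/
def IsBelief {n : ℕ} (p : Fin n → ℝ) : Prop :=
  (∀ k, 0 ≤ p k) ∧ ∑ k, p k = 1

/-- The measure on a finite type associated with a probability vector. -/
noncomputable def vecMeasure {α : Type*} [Fintype α] [MeasurableSpace α] (p : α → ℝ) :
    Measure α :=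
  ∑ x : α, ENNReal.ofReal (p x) • Measure.dirac x

/-- The Dirac belief at a point. -/
def diracBelief {n : ℕ} (k : Fin n) : Fin n → ℝ := fun k' => if k' = k then 1 else 0

/-- The `i`-th binary digit of a real number `x ∈ [0,1)` (as a real number `0` or `1`). -/
noncomputable def digitR (x : ℝ) (i : ℕ) : ℝ :=
  if ⌊x * 2 ^ (i + 1)⌋ % 2 = 1 then 1 else 0

/-- From one uniform seed `x ∈ [0,1)`, a sequence `unif x 0, unif x 1, …` of
(independent, uniformly distributed on `[0,1]`) real numbers, obtained by splitting the
binary digits of `x` along the pairing function. -/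
noncomputable def unif (x : ℝ) (m : ℕ) : ℝ :=
  ∑' j : ℕ, digitR x (Nat.pair m j) / 2 ^ (j + 1)

open Classical in
/-- Inverse-transform sampling from a probability vector on `Fin n` using a seed `u ∈ [0,1]`. -/
noncomputable def sampleFin {n : ℕ} (hn : 0 < n) (p : Fin n → ℝ) (u : ℝ) : Fin n :=
  let s : Finset (Fin n) :=
    Finset.univ.filter fun y : Fin n => u < ∑ z ∈ Finset.univ.filter fun z : Fin n => z ≤ y, p z
  if hs : s.Nonempty then s.min' hs else ⟨0, hn⟩

/-- Inverse-transform sampling from a probability vector on a finite nonempty type. -/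
noncomputable def sampleOn {β : Type*} [Fintype β] [Nonempty β] (p : β → ℝ) (u : ℝ) : β :=
  (Fintype.equivFin β).symm
    (sampleFin Fintype.card_pos (fun i => p ((Fintype.equivFin β).symm i)) u)

/-- A POMDP with states `Fin nK`, actions `Fin nA`, signals `Fin nS`, transition function `q`
and reward function `g` with values in `[0,1]`. -/
structure POMDP where
  nK : ℕ
  nA : ℕ
  nS : ℕ
  hK : 0 < nK
  hA : 0 < nA
  hS : 0 < nS
  q : Fin nK → Fin nA → Fin nK × Fin nS → ℝ
  q_nonneg : ∀ k a y, 0 ≤ q k a y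
  q_sum : ∀ k a, ∑ y, q k a y = 1
  g : Fin nK → Fin nA → ℝ
  g_nonneg : ∀ k a, 0 ≤ g k a
  g_le_one : ∀ k a, g k a ≤ 1

namespace POMDP

variable (Γ : POMDP)

/-- The state space. -/
abbrev K := Fin Γ.nK
/-- The action space. -/
abbrev A := Fin Γ.nA
/-- The signal space. -/
abbrev S := Fin Γ.nS

instance : Nonempty Γ.K := ⟨⟨0, Γ.hK⟩⟩
instance : Nonempty Γ.A := ⟨⟨0, Γ.hA⟩⟩
instance : Nonempty Γ.S := ⟨⟨0, Γ.hS⟩⟩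

/-- A history: the finite sequence of past actions and signals. -/
abbrev Hist := List (Γ.A × Γ.S)

/-- A (pure) strategy: a map from histories to actions. -/
abbrev Strategy := Γ.Hist → Γ.A

/-- The sample space carrying all the randomness: an initial state together with a
uniform seed in `[0,1)` used to draw all the transitions. -/
abbrev Env := Γ.K × ℝ

/-- The probability measure on the sample space induced by the initial belief `p1`:
the initial state is drawn according to `p1`, the seed uniformly on `[0,1)`. -/
noncomputable def envMeasure (p1 : Γ.K → ℝ) : Measure Γ.Env :=
  (vecMeasure p1).prod (volume.restrict (Set.Ico (0 : ℝ) 1))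

/-- The trajectory: `(Γ.traj σ ω m).1` is the state `k_{m+1}` at stage `m+1` and
`(Γ.traj σ ω m).2` is the history before stage `m+1` (of length `m`), when the
decision-maker uses strategy `σ` and the randomness is `ω`.  At each stage, the pair
(new state, signal) is drawn from `q` via inverse-transform sampling from a fresh
uniform variable. -/
noncomputable def traj (σ : Γ.Strategy) (ω : Γ.Env) : ℕ → Γ.K × Γ.Hist
  | 0 => (ω.1, [])
  | m + 1 =>
    let p := traj σ ω m
    let a := σ p.2
    let y := sampleOn (Γ.q p.1 a) (unif ω.2 m)
    (y.1, p.2 ++ [(a, y.2)])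

/-- The state `k_{m+1}` at stage `m+1` (`m` is 0-indexed). -/
noncomputable def state (σ : Γ.Strategy) (ω : Γ.Env) (m : ℕ) : Γ.K := (Γ.traj σ ω m).1

/-- The history before stage `m+1` (a list of length `m`). -/
noncomputable def hist (σ : Γ.Strategy) (ω : Γ.Env) (m : ℕ) : Γ.Hist := (Γ.traj σ ω m).2

/-- The action `a_{m+1}` played at stage `m+1`. -/
noncomputable def act (σ : Γ.Strategy) (ω : Γ.Env) (m : ℕ) : Γ.A := σ (Γ.hist σ ω m)

/-- The reward `g_{m+1}` obtained at stage `m+1`. -/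
noncomputable def rew (σ : Γ.Strategy) (ω : Γ.Env) (m : ℕ) : ℝ :=
  Γ.g (Γ.state σ ω m) (Γ.act σ ω m)

/-- The average reward over the first `n` stages. -/
noncomputable def avg (σ : Γ.Strategy) (ω : Γ.Env) (n : ℕ) : ℝ :=
  (1 / n : ℝ) * ∑ m ∈ Finset.range n, Γ.rew σ ω m

/-- The probability of an event under initial belief `p1` (the strategy `σ` is recorded for
readability; the underlying measure does not depend on it). -/
noncomputable def prob (p1 : Γ.K → ℝ) (_σ : Γ.Strategy) (E : Set Γ.Env) : ℝ :=
  (Γ.envMeasure p1 E).toReal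

/-- The long-run average payoff `γ^{p1}_∞(σ) = E[liminf (1/n) ∑ g_m]`. -/
noncomputable def pay (p1 : Γ.K → ℝ) (σ : Γ.Strategy) : ℝ :=
  ∫ ω, atTop.liminf (Γ.avg σ ω) ∂(Γ.envMeasure p1)

/-- The payoff starting from a deterministic state `k`, i.e. `γ^k_∞(σ)`. -/
noncomputable def payK (k : Γ.K) (σ : Γ.Strategy) : ℝ := Γ.pay (diracBelief k) σ

/-- The value `v_∞(p1)`. -/
noncomputable def val (p1 : Γ.K → ℝ) : ℝ := ⨆ σ : Γ.Strategy, Γ.pay p1 σ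

/-- A strategy has finite memory if it is implemented by a finite-state transducer. -/
def FiniteMemory (σ : Γ.Strategy) : Prop :=
  ∃ (n : ℕ) (m0 : Fin n) (σa : Fin n → Γ.A) (σu : Fin n → Γ.A × Γ.S → Fin n),
    ∀ h : Γ.Hist, σ h = σa (h.foldl σu m0)

/-- A blind MDP: the signal set is a singleton. -/
def Blind : Prop := Γ.nS = 1

/-- The strategy induced by a sequence of actions `a_1, a_2, …` (`as m` is the action played
at stage `m+1`, regardless of the observed history). -/
def blindStrat (as : ℕ → Γ.A) : Γ.Strategy := fun h => as h.length

end POMDP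

/-- A sequence is eventually periodic if it is periodic with some period `T ≥ 1` from
some stage `N` on. -/
def EventuallyPeriodic {α : Type*} (as : ℕ → α) : Prop :=
  ∃ T ≥ 1, ∃ N ≥ 1, ∀ m ≥ N, as (m + T) = as m


section
open ProbabilityTheory

noncomputable abbrev lam : Measure ℝ := volume.restrict (Set.Ico (0 : ℝ) 1)

instance lam_prob : IsProbabilityMeasure lam := ⟨by simp [lam]⟩

lemma measurable_digitR (i : ℕ) : Measurable (fun x => digitR x i) := by
  unfold digitR
  refine Measurable.ite ?_ measurable_const measurable_const
  have h : Measurable (fun x : ℝ => ⌊x * 2 ^ (i + 1)⌋ % 2) :=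
    (measurable_from_top (f := fun z : ℤ => z % 2)).comp
      (Int.measurable_floor.comp (measurable_id.mul_const _))
  exact h (measurableSet_singleton (1 : ℤ))

lemma digitR_zero_lo {x : ℝ} (h0 : 0 ≤ x) (h1 : x < 1 / 2) : digitR x 0 = 0 := by
  have : ⌊x * 2 ^ (0 + 1)⌋ = 0 := by
    rw [Int.floor_eq_iff]; norm_num; constructor <;> linarith
  simp only [digitR, this]; norm_num

lemma digitR_zero_hi {x : ℝ} (h0 : 1 / 2 ≤ x) (h1 : x < 1) : digitR x 0 = 1 := by
  have : ⌊x * 2 ^ (0 + 1)⌋ = 1 := by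
    rw [Int.floor_eq_iff]; norm_num; constructor <;> linarith
  simp only [digitR, this]; norm_num

lemma digitR_succ (x : ℝ) (i : ℕ) : digitR x (i + 1) = digitR (2 * x) i := by
  unfold digitR
  rw [show x * 2 ^ (i + 1 + 1) = 2 * x * 2 ^ (i + 1) by ring]

lemma digitR_sub_one (x : ℝ) (i : ℕ) : digitR (x - 1) i = digitR x i := by
  unfold digitR
  have : (x - 1) * 2 ^ (i + 1) = x * 2 ^ (i + 1) - ((2 ^ (i + 1) : ℤ) : ℝ) := by
    push_cast; ring
  rw [this, Int.floor_sub_intCast]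
  have : (⌊x * 2 ^ (i + 1)⌋ - 2 ^ (i + 1)) % 2 = ⌊x * 2 ^ (i + 1)⌋ % 2 := by
    rw [pow_succ]; omega
  rw [this]

lemma digitR_sum {x : ℝ} (N : ℕ) (h0 : 0 ≤ x) (h1 : x < 1) :
    ∑ j ∈ Finset.range N, digitR x j / 2 ^ (j + 1) ≤ x ∧
    x ≤ ∑ j ∈ Finset.range N, digitR x j / 2 ^ (j + 1) + 1 / 2 ^ N := by
  induction N generalizing x with
  | zero => simp; exact ⟨h0, h1.le⟩
  | succ N ih =>
    rw [Finset.sum_range_succ']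
    have key : ∀ y, (∀ j, digitR x (j+1) = digitR y j) →
      ∑ j ∈ Finset.range N, digitR x (j+1) / 2 ^ (j + 1 + 1) =
        (∑ j ∈ Finset.range N, digitR y j / 2 ^ (j + 1)) / 2 := by
      intro y hy
      rw [Finset.sum_div]
      refine Finset.sum_congr rfl fun j _ => ?_
      rw [hy, pow_succ _ (j+1)]; field_simp
    have e : (1:ℝ) / 2 ^ (N+1) = (1 / 2 ^ N) / 2 := by rw [pow_succ]; field_simp
    rw [e]
    rcases lt_or_ge x (1/2) with h | h
    · rw [key (2 * x) (fun j => digitR_succ x j), digitR_zero_lo h0 h]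
      have := ih (x := 2 * x) (by linarith) (by linarith)
      constructor
      · have := this.1; norm_num; linarith
      · have := this.2; norm_num at this ⊢; linarith
    · rw [key (2 * x - 1) (fun j => by rw [digitR_succ, digitR_sub_one]), digitR_zero_hi h h1]
      have := ih (x := 2 * x - 1) (by linarith) (by linarith)
      constructor
      · have := this.1; norm_num; linarith
      · have := this.2; norm_num at this ⊢; linarith

lemma digitR_nonneg (x : ℝ) (i : ℕ) : 0 ≤ digitR x i := by
  unfold digitR; split_ifs <;> norm_num

lemma digitR_tsum {x : ℝ} (h0 : 0 ≤ x) (h1 : x < 1) :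
    ∑' j : ℕ, digitR x j / 2 ^ (j + 1) = x := by
  apply HasSum.tsum_eq
  rw [hasSum_iff_tendsto_nat_of_nonneg (fun i => div_nonneg (digitR_nonneg x i) (by positivity))]
  have h2 : Tendsto (fun N : ℕ => x - 1 / 2 ^ N) atTop (nhds x) := by
    have := tendsto_pow_atTop_nhds_zero_of_lt_one (r := (1/2 : ℝ)) (by norm_num) (by norm_num)
    have := this.const_sub x
    simpa using this
  refine tendsto_of_tendsto_of_tendsto_of_le_of_le h2 tendsto_const_nhds ?_ ?_
  · intro N; have := (digitR_sum N h0 h1).2; simp only; linarith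
  · intro N; exact (digitR_sum N h0 h1).1

/-- doubling maps -/
lemma vol_half (c : ℝ) (B : Set ℝ) (hB : MeasurableSet B) :
    volume ((fun x : ℝ => 2 * x - c) ⁻¹' B) = ENNReal.ofReal (1/2) * volume B := by
  have h1 : (fun x : ℝ => 2 * x - c) ⁻¹' B = (fun x : ℝ => 2 * x) ⁻¹' ((fun x : ℝ => x - c) ⁻¹' B) := rfl
  rw [h1, Real.volume_preimage_mul_left (by norm_num : (2:ℝ) ≠ 0)]
  have h2 : (fun x : ℝ => x - c) ⁻¹' B = (fun x : ℝ => x + (-c)) ⁻¹' B := rfl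
  rw [h2, measure_preimage_add_right]
  norm_num

lemma digit_step (s : Set ℝ) (C B : Set ℝ) (hB : MeasurableSet B)
    (hC : ∀ x, x ∈ C ↔ 2 * x ∈ B) (hper : ∀ x, x - 1 ∈ B ↔ x ∈ B) :
    lam ((fun x => digitR x 0) ⁻¹' s ∩ C) =
      (s.indicator (fun _ => ENNReal.ofReal (1/2)) 0 +
        s.indicator (fun _ => ENNReal.ofReal (1/2)) 1) * lam B := by
  classical
  have hsplit : ((fun x => digitR x 0) ⁻¹' s ∩ C) ∩ Set.Ico (0:ℝ) 1 =
      (if (0:ℝ) ∈ s then (fun x : ℝ => 2 * x - 0) ⁻¹' (B ∩ Set.Ico 0 1) else ∅) ∪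
      (if (1:ℝ) ∈ s then (fun x : ℝ => 2 * x - 1) ⁻¹' (B ∩ Set.Ico 0 1) else ∅) := by
    ext x
    simp only [Set.mem_inter_iff, Set.mem_preimage, Set.mem_Ico, Set.mem_union, hC]
    constructor
    · rintro ⟨⟨h1, h2⟩, h3, h4⟩
      rcases lt_or_ge x (1/2) with h | h
      · rw [digitR_zero_lo h3 h] at h1
        left; rw [if_pos h1]; refine ⟨by simpa using h2, ?_, ?_⟩ <;> simp <;> linarith
      · rw [digitR_zero_hi h h4] at h1
        right; rw [if_pos h1]; refine ⟨(hper _).2 h2, ?_, ?_⟩ <;> simp <;> linarith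
    · rintro (h | h)
      · split_ifs at h with hs
        · obtain ⟨h1, h2, h3⟩ := h
          simp only [sub_zero] at h1 h2 h3
          rw [digitR_zero_lo (by linarith) (by linarith)]
          exact ⟨⟨hs, h1⟩, by linarith, by linarith⟩
        · exact absurd h (Set.notMem_empty x)
      · split_ifs at h with hs
        · obtain ⟨h1, h2, h3⟩ := h
          simp only at h1 h2 h3
          rw [digitR_zero_hi (by linarith) (by linarith)]
          exact ⟨⟨hs, (hper _).1 h1⟩, by linarith, by linarith⟩
        · exact absurd h (Set.notMem_empty x)
  have hm : MeasurableSet (B ∩ Set.Ico (0:ℝ) 1) := hB.inter measurableSet_Ico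
  rw [lam, Measure.restrict_apply' measurableSet_Ico, hsplit, measure_union, 
    Measure.restrict_apply' measurableSet_Ico, add_mul]
  · congr 1
    · by_cases h : (0:ℝ) ∈ s
      · rw [if_pos h, Set.indicator_of_mem h, vol_half _ _ hm]
      · rw [if_neg h, Set.indicator_of_notMem h]; simp
    · by_cases h : (1:ℝ) ∈ s
      · rw [if_pos h, Set.indicator_of_mem h, vol_half _ _ hm]
      · rw [if_neg h, Set.indicator_of_notMem h]; simp
  · rw [Set.disjoint_left]
    intro x hx hy
    split_ifs at hx with h
    · split_ifs at hy with h'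
      · have h1 := hx.2.2; have h2 := hy.2.1; simp only at h1 h2; linarith
      · exact hy
    · exact hx
  · split_ifs
    · exact hm.preimage (by fun_prop)
    · exact MeasurableSet.empty

noncomputable def bw (s : Set ℝ) : ENNReal := s.indicator (fun _ => ENNReal.ofReal (1/2)) 0 +
        s.indicator (fun _ => ENNReal.ofReal (1/2)) 1

lemma digits_prod (N : ℕ) (t : ℕ → Set ℝ) (ht : ∀ i, MeasurableSet (t i)) :
    lam {x | ∀ i < N, digitR x i ∈ t i} = ∏ i ∈ Finset.range N, bw (t i) := by
  induction N generalizing t with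
  | zero => simp
  | succ N ih =>
    rw [Finset.prod_range_succ', ← ih (fun i => t (i+1)) (fun i => ht _), mul_comm, bw,
      ← digit_step (t 0) {x | ∀ i < N, digitR (2 * x) i ∈ t (i+1)}]
    · congr 1; ext x
      simp only [Set.mem_ofPred_eq, Set.mem_inter_iff, Set.mem_preimage]
      constructor
      · intro h
        exact ⟨h 0 (by omega), fun i hi => by rw [← digitR_succ]; exact h (i+1) (by omega)⟩
      · rintro ⟨h0, h⟩ i hi
        cases i with
        | zero => exact h0
        | succ i => rw [digitR_succ]; exact h i (by omega)
    · have : {x | ∀ i < N, digitR x i ∈ t (i+1)} = ⋂ i, ⋂ (_ : i < N), (fun x => digitR x i) ⁻¹' (t (i+1)) := by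
        ext; simp
      rw [this]
      exact MeasurableSet.iInter fun i => MeasurableSet.iInter fun _ => measurable_digitR i (ht _)
    · intro x; rfl
    · intro x; simp only [Set.mem_ofPred_eq, digitR_sub_one]

lemma bw_univ : bw Set.univ = 1 := by
  simp only [bw, Set.indicator_univ]
  rw [← ENNReal.ofReal_add] <;> norm_num

lemma law_digit (i : ℕ) (s : Set ℝ) (hs : MeasurableSet s) :
    lam.map (fun x => digitR x i) s = bw s := by
  classical
  rw [Measure.map_apply (measurable_digitR i) hs]
  have := digits_prod (i+1) (fun j => if j = i then s else Set.univ)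
    (fun j => by split_ifs <;> simp [hs])
  have e : {x | ∀ j < i + 1, digitR x j ∈ (if j = i then s else Set.univ)} = (fun x => digitR x i) ⁻¹' s := by
    ext x; simp only [Set.mem_ofPred_eq, Set.mem_preimage]
    constructor
    · intro h; simpa using h i (by omega)
    · intro h j _; split_ifs with hj
      · subst hj; exact h
      · trivial
  rw [e] at this
  rw [this, Finset.prod_eq_single i]
  · simp
  · intro j _ hj; simp [hj, bw_univ]
  · simp

noncomputable def bet : Measure ℝ := lam.map (fun x => digitR x 0)
instance : IsProbabilityMeasure bet := Measure.isProbabilityMeasure_map (measurable_digitR 0).aemeasurable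

lemma measurable_digits : Measurable (fun x i => digitR x i) :=
  measurable_pi_iff.2 measurable_digitR

lemma law_digits : lam.map (fun x i => digitR x i) = Measure.infinitePi (fun _ : ℕ => bet) := by
  classical
  refine Measure.eq_infinitePi _ fun s t ht => ?_
  rw [Measure.map_apply measurable_digits (MeasurableSet.pi s.countable_toSet (fun i _ => ht i))]
  obtain ⟨N, hN⟩ : ∃ N, s ⊆ Finset.range N := by
    exact ⟨s.sup id + 1, fun i hi => by
      simp only [Finset.mem_range]; exact Nat.lt_succ_of_le (Finset.le_sup (f := id) hi)⟩
  have := digits_prod N (fun j => if j ∈ s then t j else Set.univ)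
    (fun j => by split_ifs <;> simp [ht])
  have e : {x | ∀ j < N, digitR x j ∈ (if j ∈ s then t j else Set.univ)} = 
      (fun x i => digitR x i) ⁻¹' ((s : Set ℕ).pi t) := by
    ext x; simp only [Set.mem_ofPred_eq, Set.mem_preimage, Set.mem_pi]
    constructor
    · intro h i hi; simpa [Finset.mem_coe.1 hi] using h i (Finset.mem_range.1 (hN hi))
    · intro h j _; split_ifs with hj
      · exact h j hj
      · trivial
  rw [e] at this
  rw [this, ← Finset.prod_subset hN]
  · refine Finset.prod_congr rfl fun i hi => ?_
    rw [if_pos hi, bet, law_digit 0 _ (ht i)]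
  · intro j _ hj; simp [hj, bw_univ]

noncomputable def dsum (d : ℕ → ℝ) : ℝ := ∑' j : ℕ, d j / 2 ^ (j + 1)

lemma measurable_dsum : Measurable dsum := by
  unfold dsum
  exact Measurable.tsum (fun j => (measurable_pi_apply j).div_const _)

lemma law_dsum : (Measure.infinitePi (fun _ : ℕ => bet)).map dsum = lam := by
  rw [← law_digits, Measure.map_map measurable_dsum measurable_digits]
  have : (dsum ∘ fun x i => digitR x i) =ᵐ[lam] id := by
    filter_upwards [ae_restrict_mem measurableSet_Ico] with x hx
    exact digitR_tsum hx.1 hx.2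
  rw [Measure.map_congr this, Measure.map_id]

lemma measurable_unif (m : ℕ) : Measurable (fun x => unif x m) := by
  have : (fun x => unif x m) = dsum ∘ (fun d : ℕ → ℝ => fun j => d (Nat.pair m j)) ∘ (fun x i => digitR x i) := rfl
  rw [this]
  exact measurable_dsum.comp ((measurable_pi_iff.2 fun j => measurable_pi_apply _).comp measurable_digits)

lemma law_unif : lam.map (fun x m => unif x m) = Measure.infinitePi (fun _ : ℕ => lam) := by
  have e : (fun x m => unif x m) = (fun (d : ℕ → ℕ → ℝ) m => dsum (d m)) ∘
      (MeasurableEquiv.curry ℕ ℕ ℝ) ∘ (fun (d : ℕ → ℝ) (p : ℕ × ℕ) => d (Nat.pairEquiv p)) ∘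
      (fun x i => digitR x i) := rfl
  have m1 : Measurable (fun (d : ℕ → ℝ) (p : ℕ × ℕ) => d (Nat.pairEquiv p)) := by fun_prop
  have m2 : Measurable (fun (d : ℕ → ℕ → ℝ) m => dsum (d m)) :=
    measurable_pi_iff.2 fun m => measurable_dsum.comp (measurable_pi_apply m)
  rw [e, ← Measure.map_map m2 ((MeasurableEquiv.measurable _).comp (m1.comp measurable_digits)),
    ← Measure.map_map (MeasurableEquiv.measurable _) (m1.comp measurable_digits),
    ← Measure.map_map m1 measurable_digits, law_digits,
    Measure.map_infinitePi_infinitePi_of_inj Nat.pairEquiv.injective]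
  rw [Measure.infinitePi_map_curry (fun _ _ => bet)]
  rw [Measure.infinitePi_map_pi (f := fun _ => dsum) _ (fun _ => measurable_dsum)]
  simp only [law_dsum]

end

section
open Matrix

/-- shift of a sequence -/
def sh {α : Type*} (m : ℕ) (a : ℕ → α) : ℕ → α := fun i => a (i + m)

lemma sh_sh {α : Type*} (m n : ℕ) (a : ℕ → α) : sh n (sh m a) = sh (m + n) a := by
  funext i; simp only [sh]; congr 1; omega

lemma sh_zero {α : Type*} (a : ℕ → α) : sh 0 a = a := rfl

set_option linter.unusedSectionVars false
set_option linter.unusedVariables false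

section mat
variable {K A : Type} [Fintype K] [DecidableEq K]

/-- stochastic matrices -/
structure Stoch (M : A → Matrix K K ℝ) : Prop where
  nn : ∀ a k k', 0 ≤ M a k k'
  row : ∀ a k, ∑ k', M a k k' = 1

/-- transition matrices -/
noncomputable def Tr (M : A → Matrix K K ℝ) (a : ℕ → A) : ℕ → Matrix K K ℝ
  | 0 => 1
  | m + 1 => Tr M a m * M (a m)

/-- expected total reward -/
noncomputable def Hh (M : A → Matrix K K ℝ) (g : K → A → ℝ) (n : ℕ) (a : ℕ → A) : K → ℝ :=
  ∑ s ∈ Finset.range n, Tr M a s *ᵥ (fun k => g k (a s))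

variable {M : A → Matrix K K ℝ} {g : K → A → ℝ}

lemma Tr_add (a : ℕ → A) (m n : ℕ) : Tr M a (m + n) = Tr M a m * Tr M (sh m a) n := by
  induction n with
  | zero => simp [Tr]
  | succ n ih =>
    rw [← add_assoc, Tr, ih, Tr, Matrix.mul_assoc]
    simp only [sh]; rw [add_comm n m]

lemma Tr_nonneg (hM : Stoch M) (a : ℕ → A) (m : ℕ) (k k' : K) : 0 ≤ Tr M a m k k' := by
  induction m generalizing k' with
  | zero => simp only [Tr, Matrix.one_apply]; split_ifs <;> norm_num
  | succ m ih =>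
    rw [Tr, Matrix.mul_apply]
    exact Finset.sum_nonneg fun j _ => mul_nonneg (ih j) (hM.nn _ _ _)

lemma Tr_row (hM : Stoch M) (a : ℕ → A) (m : ℕ) (k : K) : ∑ k', Tr M a m k k' = 1 := by
  induction m with
  | zero => simp [Tr, Matrix.one_apply]
  | succ m ih =>
    simp only [Tr, Matrix.mul_apply]
    rw [Finset.sum_comm]
    simp only [← Finset.mul_sum, hM.row, mul_one, ih]

lemma H_add (a : ℕ → A) (m n : ℕ) :
    Hh M g (m + n) a = Hh M g m a + Tr M a m *ᵥ Hh M g n (sh m a) := by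
  unfold Hh
  rw [Finset.sum_range_add, Matrix.mulVec_sum]
  congr 1
  refine Finset.sum_congr rfl fun s _ => ?_
  rw [Tr_add, Matrix.mulVec_mulVec]
  simp only [sh]; rw [add_comm s m]

lemma Tr_mulVec_le (hM : Stoch M) (a : ℕ → A) (m : ℕ) (φ : K → ℝ) (C : ℝ) (h : ∀ k, φ k ≤ C) (k : K) :
    (Tr M a m *ᵥ φ) k ≤ C := by
  calc (Tr M a m *ᵥ φ) k = ∑ k', Tr M a m k k' * φ k' := rfl
    _ ≤ ∑ k', Tr M a m k k' * C :=
      Finset.sum_le_sum fun k' _ => mul_le_mul_of_nonneg_left (h k') (Tr_nonneg hM a m k k')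
    _ = C := by rw [← Finset.sum_mul, Tr_row hM, one_mul]

lemma Tr_mulVec_nonneg (hM : Stoch M) (a : ℕ → A) (m : ℕ) (φ : K → ℝ) (h : ∀ k, 0 ≤ φ k) (k : K) :
    0 ≤ (Tr M a m *ᵥ φ) k :=
  Finset.sum_nonneg fun k' _ => mul_nonneg (Tr_nonneg hM a m k k') (h k')

lemma H_nonneg (hM : Stoch M) (g0 : ∀ k a, 0 ≤ g k a) (n : ℕ) (a : ℕ → A) (k : K) :
    0 ≤ Hh M g n a k := by
  unfold Hh; rw [Finset.sum_apply]
  exact Finset.sum_nonneg fun s _ => Tr_mulVec_nonneg hM a s _ (fun k => g0 _ _) k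

lemma H_le (hM : Stoch M) (g1 : ∀ k a, g k a ≤ 1) (n : ℕ) (a : ℕ → A) (k : K) :
    Hh M g n a k ≤ n := by
  unfold Hh; rw [Finset.sum_apply]
  calc _ ≤ ∑ s ∈ Finset.range n, (1:ℝ) :=
        Finset.sum_le_sum fun s _ => Tr_mulVec_le hM a s _ 1 (fun k => g1 _ _) k
    _ = n := by simp

/-- the belief dynamics -/
noncomputable def th (M : A → Matrix K K ℝ) (t : ℕ) (x : (K → ℝ) × (ℕ → A)) : (K → ℝ) × (ℕ → A) :=
  (x.1 ᵥ* Tr M x.2 t, sh t x.2)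

lemma th_th (s t : ℕ) (x : (K → ℝ) × (ℕ → A)) : th M t (th M s x) = th M (s + t) x := by
  simp only [th, sh_sh, Matrix.vecMul_vecMul, Tr_add]

lemma th_zero (x : (K → ℝ) × (ℕ → A)) : th M 0 x = x := by
  simp [th, Tr, sh_zero]

/-- belief -/
def IsB (p : K → ℝ) : Prop := (∀ k, 0 ≤ p k) ∧ ∑ k, p k = 1

lemma th_B (hM : Stoch M) (t : ℕ) (x : (K → ℝ) × (ℕ → A)) (hx : IsB x.1) : IsB (th M t x).1 := by
  constructor
  · intro k; exact Finset.sum_nonneg fun j _ => mul_nonneg (hx.1 j) (Tr_nonneg hM _ _ _ _)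
  · simp only [th, Matrix.vecMul, dotProduct]
    rw [Finset.sum_comm]
    simp only [← Finset.mul_sum, Tr_row hM, mul_one, hx.2]

/-- expected total reward from a belief -/
noncomputable def Sx (M : A → Matrix K K ℝ) (g : K → A → ℝ) (n : ℕ) (x : (K → ℝ) × (ℕ → A)) : ℝ :=
  x.1 ⬝ᵥ Hh M g n x.2

lemma Sx_add (m n : ℕ) (x : (K → ℝ) × (ℕ → A)) :
    Sx M g (m + n) x = Sx M g m x + Sx M g n (th M m x) := by
  simp only [Sx, H_add, dotProduct_add, th, Matrix.dotProduct_mulVec]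

lemma IsB.dot_le {p : K → ℝ} (hp : IsB p) (φ : K → ℝ) (C : ℝ) (h : ∀ k, φ k ≤ C) : p ⬝ᵥ φ ≤ C := by
  calc p ⬝ᵥ φ = ∑ k, p k * φ k := rfl
    _ ≤ ∑ k, p k * C := Finset.sum_le_sum fun k _ => mul_le_mul_of_nonneg_left (h k) (hp.1 k)
    _ = C := by rw [← Finset.sum_mul, hp.2, one_mul]

lemma IsB.dot_nonneg {p : K → ℝ} (hp : IsB p) (φ : K → ℝ) (h : ∀ k, 0 ≤ φ k) : 0 ≤ p ⬝ᵥ φ :=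
  Finset.sum_nonneg fun k _ => mul_nonneg (hp.1 k) (h k)

lemma sum_shift_ge (ρ : ℕ → ℝ) (C : ℝ) (h0 : ∀ i, 0 ≤ ρ i) (h1 : ∀ i, ρ i ≤ C) (s N : ℕ) :
    ∑ t ∈ Finset.range N, ρ t - s * C ≤ ∑ t ∈ Finset.range N, ρ (t + s) := by
  induction s with
  | zero => simp
  | succ s ih =>
    have : ∑ t ∈ Finset.range N, ρ (t + (s + 1)) + ρ s = ∑ t ∈ Finset.range N, ρ (t + s) + ρ (N + s) := by
      have e1 := Finset.sum_range_succ (fun t => ρ (t + s)) N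
      have e2 := Finset.sum_range_succ' (fun t => ρ (t + s)) N
      simp only [zero_add] at e2
      rw [← e1, e2]
      congr 1; exact Finset.sum_congr rfl fun t _ => by congr 1; omega
    have := h0 (N + s); have := h1 s
    push_cast; linarith

lemma sum_shift_le (ρ : ℕ → ℝ) (C : ℝ) (h0 : ∀ i, 0 ≤ ρ i) (h1 : ∀ i, ρ i ≤ C) (s N : ℕ) :
    ∑ t ∈ Finset.range N, ρ (t + s) ≤ ∑ t ∈ Finset.range N, ρ t + s * C := by
  have := sum_shift_ge (fun i => C - ρ i) C (fun i => by linarith [h1 i]) (fun i => by linarith [h0 i]) s N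
  simp only [Finset.sum_sub_distrib] at this
  linarith

lemma Sx_eq_sum (n : ℕ) (x : (K → ℝ) × (ℕ → A)) :
    Sx M g n x = ∑ s ∈ Finset.range n, Sx M g 1 (th M s x) := by
  induction n with
  | zero => simp [Sx, Hh]
  | succ n ih => rw [Sx_add, ih, Finset.sum_range_succ]

/-- Lemma A -/
lemma sum_Sx_ge (hM : Stoch M) (g0 : ∀ k a, 0 ≤ g k a) (g1 : ∀ k a, g k a ≤ 1)
    (n N : ℕ) (x : (K → ℝ) × (ℕ → A)) (hx : IsB x.1) :
    n * Sx M g N x - n * n ≤ ∑ t ∈ Finset.range N, Sx M g n (th M t x) := by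
  have e : ∑ t ∈ Finset.range N, Sx M g n (th M t x) =
      ∑ s ∈ Finset.range n, ∑ t ∈ Finset.range N, Sx M g 1 (th M (t + s) x) := by
    rw [Finset.sum_comm]
    refine Finset.sum_congr rfl fun t _ => ?_
    rw [Sx_eq_sum]; simp only [th_th]
  have h0 : ∀ i, 0 ≤ Sx M g 1 (th M i x) := fun i =>
    (th_B hM i x hx).dot_nonneg _ (fun k => H_nonneg hM g0 _ _ _)
  have h1 : ∀ i, Sx M g 1 (th M i x) ≤ 1 := fun i =>
    (th_B hM i x hx).dot_le _ _ (fun k => by simpa using H_le hM g1 1 _ k)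
  rw [e]
  calc (n:ℝ) * Sx M g N x - n * n = ∑ s ∈ Finset.range n, (Sx M g N x - n) := by
        simp [mul_sub]
    _ ≤ _ := by
      refine Finset.sum_le_sum fun s hs => ?_
      have := sum_shift_ge (fun i => Sx M g 1 (th M i x)) 1 h0 h1 s N
      rw [Sx_eq_sum]
      have : (s:ℝ) ≤ n := by exact_mod_cast (Finset.mem_range.1 hs).le
      linarith

/-- the variation functional -/
noncomputable def Fx (M : A → Matrix K K ℝ) (g : K → A → ℝ) (m n : ℕ) (x : (K → ℝ) × (ℕ → A)) : ℝ :=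
  ∑ k, ∑ k', x.1 k * Tr M x.2 m k k' * (Hh M g n (sh m x.2) k' - Hh M g n x.2 k) ^ 2

noncomputable def ph (M : A → Matrix K K ℝ) (g : K → A → ℝ) (n : ℕ) (x : (K → ℝ) × (ℕ → A)) : ℝ :=
  x.1 ⬝ᵥ (fun k => Hh M g n x.2 k ^ 2)

/-- Lemma B -/
lemma Fx_le (hM : Stoch M) (g0 : ∀ k a, 0 ≤ g k a) (g1 : ∀ k a, g k a ≤ 1)
    (m n : ℕ) (x : (K → ℝ) × (ℕ → A)) (hx : IsB x.1) :
    Fx M g m n x ≤ ph M g n (th M m x) - ph M g n x + 2 * m * n := by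
  set h := Hh M g n x.2 with hh
  set h' := Hh M g n (sh m x.2) with hh'
  have e : Fx M g m n x = ph M g n (th M m x) + ph M g n x -
      2 * ∑ k, x.1 k * (h k * (Tr M x.2 m *ᵥ h') k) := by
    have e1 : ph M g n (th M m x) = ∑ k, ∑ k', x.1 k * Tr M x.2 m k k' * h' k' ^ 2 := by
      simp only [ph, th, dotProduct, Matrix.vecMul]
      rw [Finset.sum_comm]
      exact Finset.sum_congr rfl fun k _ => by rw [Finset.sum_mul]
    have e2 : ph M g n x = ∑ k, ∑ k', x.1 k * Tr M x.2 m k k' * h k ^ 2 := by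
      simp only [ph, dotProduct]
      refine Finset.sum_congr rfl fun k _ => ?_
      rw [← Finset.sum_mul, ← Finset.mul_sum, Tr_row hM, mul_one]
    have e3 : ∑ k, x.1 k * (h k * (Tr M x.2 m *ᵥ h') k) =
        ∑ k, ∑ k', x.1 k * Tr M x.2 m k k' * (h k * h' k') := by
      refine Finset.sum_congr rfl fun k _ => ?_
      simp only [Matrix.mulVec, dotProduct]
      rw [Finset.mul_sum, Finset.mul_sum]
      exact Finset.sum_congr rfl fun k' _ => by ring
    rw [e1, e2, e3, Finset.mul_sum, ← Finset.sum_add_distrib, ← Finset.sum_sub_distrib, Fx]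
    refine Finset.sum_congr rfl fun k _ => ?_
    rw [Finset.mul_sum, ← Finset.sum_add_distrib, ← Finset.sum_sub_distrib]
    refine Finset.sum_congr rfl fun k' _ => ?_
    ring
  have key : ∑ k, x.1 k * (h k * (Tr M x.2 m *ᵥ h') k) ≥ ph M g n x - m * n := by
    have : ∑ k, x.1 k * (h k * (Tr M x.2 m *ᵥ h') k) ≥ ∑ k, (x.1 k * h k ^ 2 - x.1 k * (m * n)) := by
      refine Finset.sum_le_sum fun k _ => ?_
      rw [← mul_sub]
      refine mul_le_mul_of_nonneg_left ?_ (hx.1 k)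
      have a1 : (Tr M x.2 m *ᵥ h') k ≥ h k - m := by
        have b1 := congrFun (H_add (M := M) (g := g) x.2 m n) k
        have b2 := congrFun (H_add (M := M) (g := g) x.2 n m) k
        rw [add_comm n m, b1] at b2
        simp only [Pi.add_apply] at b2
        have b3 := H_le hM g1 m x.2 k
        have b4 := Tr_mulVec_nonneg hM x.2 n _ (H_nonneg hM g0 m (sh n x.2)) k
        linarith
      have a2 : 0 ≤ h k := H_nonneg hM g0 n x.2 k
      have a3 : h k ≤ n := H_le hM g1 n x.2 k
      have a4 := mul_le_mul_of_nonneg_left a1 a2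
      have a5 : h k * m ≤ n * m := mul_le_mul_of_nonneg_right a3 (by positivity)
      nlinarith
    rw [Finset.sum_sub_distrib, ← Finset.sum_mul, hx.2, one_mul] at this
    exact this
  rw [e]; linarith

lemma Fx_nonneg (hM : Stoch M) (m n : ℕ) (x : (K → ℝ) × (ℕ → A)) (hx : IsB x.1) : 0 ≤ Fx M g m n x :=
  Finset.sum_nonneg fun k _ => Finset.sum_nonneg fun k' _ =>
    mul_nonneg (mul_nonneg (hx.1 k) (Tr_nonneg hM _ _ _ _)) (sq_nonneg _)

lemma sum_Fx_le (hM : Stoch M) (g0 : ∀ k a, 0 ≤ g k a) (g1 : ∀ k a, g k a ≤ 1)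
    (m n N : ℕ) (x : (K → ℝ) × (ℕ → A)) (hx : IsB x.1) :
    ∑ t ∈ Finset.range N, Fx M g m n (th M t x) ≤ m * n ^ 2 + 2 * m * n * N := by
  have h1 : ∑ t ∈ Finset.range N, Fx M g m n (th M t x) ≤
    ∑ t ∈ Finset.range N, (ph M g n (th M (t + m) x) - ph M g n (th M t x) + 2 * m * n) := by
    refine Finset.sum_le_sum fun t _ => ?_
    have := Fx_le hM g0 g1 m n (th M t x) (th_B hM t x hx)
    rwa [th_th] at this
  have h2 := sum_shift_le (fun t => ph M g n (th M t x)) (n ^ 2)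
    (fun i => (th_B hM i x hx).dot_nonneg _ fun k => sq_nonneg _)
    (fun i => (th_B hM i x hx).dot_le _ _ fun k =>
      pow_le_pow_left₀ (H_nonneg hM g0 _ _ _) (H_le hM g1 _ _ _) 2) m N
  rw [Finset.sum_add_distrib, Finset.sum_sub_distrib] at h1
  simp only [Finset.sum_const, Finset.card_range, nsmul_eq_mul] at h1
  linarith

end mat

end

section
open Matrix
set_option linter.unusedSectionVars false
set_option linter.unusedVariables false
section cpt
variable {K A : Type} [Fintype K] [DecidableEq K] [Nonempty A]
  {M : A → Matrix K K ℝ} {g : K → A → ℝ}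

def Reach (M : A → Matrix K K ℝ) (p1 : K → ℝ) (x : (K → ℝ) × (ℕ → A)) : Prop :=
  ∃ m b, x = th M m (p1, b)

lemma Reach.th {p1 : K → ℝ} {x : (K → ℝ) × (ℕ → A)} (h : Reach M p1 x) (t : ℕ) :
    Reach M p1 (th M t x) := by
  obtain ⟨m, b, rfl⟩ := h
  exact ⟨m + t, b, th_th _ _ _⟩

lemma Reach.B (hM : Stoch M) {p1 : K → ℝ} (hp : IsB p1) {x : (K → ℝ) × (ℕ → A)} (h : Reach M p1 x) :
    IsB x.1 := by
  obtain ⟨m, b, rfl⟩ := h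
  exact th_B hM m _ hp

noncomputable def Wn (M : A → Matrix K K ℝ) (g : K → A → ℝ) (p1 : K → ℝ) (n : ℕ) : ℝ :=
  sSup {r | ∃ x, Reach M p1 x ∧ r = Sx M g n x}

lemma Sx_le (hM : Stoch M) (g1 : ∀ k a, g k a ≤ 1) (n : ℕ) (x : (K → ℝ) × (ℕ → A)) (hx : IsB x.1) :
    Sx M g n x ≤ n := hx.dot_le _ _ (fun k => H_le hM g1 n _ k)

lemma Sx_nonneg (hM : Stoch M) (g0 : ∀ k a, 0 ≤ g k a) (n : ℕ) (x : (K → ℝ) × (ℕ → A)) (hx : IsB x.1) :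
    0 ≤ Sx M g n x := hx.dot_nonneg _ (fun k => H_nonneg hM g0 n _ k)

lemma Sx_le_W (hM : Stoch M) (g1 : ∀ k a, g k a ≤ 1) {p1 : K → ℝ} (hp : IsB p1) (n : ℕ)
    {x : (K → ℝ) × (ℕ → A)} (h : Reach M p1 x) : Sx M g n x ≤ Wn M g p1 n := by
  refine le_csSup ⟨n, ?_⟩ ⟨x, h, rfl⟩
  rintro r ⟨y, hy, rfl⟩
  exact Sx_le hM g1 n y (hy.B hM hp)

lemma W_nonempty (p1 : K → ℝ) (n : ℕ) : {r | ∃ x, Reach M p1 x ∧ r = Sx M g n x}.Nonempty :=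
  ⟨_, th M 0 (p1, fun _ => Classical.arbitrary A), ⟨0, _, rfl⟩, rfl⟩

lemma W_sub (hM : Stoch M) (g1 : ∀ k a, g k a ≤ 1) {p1 : K → ℝ} (hp : IsB p1) :
    Subadditive (Wn M g p1) := by
  intro m n
  refine csSup_le (W_nonempty p1 _) ?_
  rintro r ⟨x, hx, rfl⟩
  rw [Sx_add]
  exact add_le_add (Sx_le_W hM g1 hp m hx) (Sx_le_W hM g1 hp n (hx.th m))

/-- the combined functional -/
noncomputable def Ph (M : A → Matrix K K ℝ) (g : K → A → ℝ) (p1 : K → ℝ) (i n : ℕ)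
    (x : (K → ℝ) × (ℕ → A)) : ℝ :=
  (Wn M g p1 n - Sx M g n x) / n + ∑ m ∈ Finset.range (i + 1), Fx M g m n x / n ^ 2

lemma Ph_nonneg (hM : Stoch M) (g1 : ∀ k a, g k a ≤ 1) {p1 : K → ℝ} (hp : IsB p1) (i n : ℕ)
    {x : (K → ℝ) × (ℕ → A)} (h : Reach M p1 x) : 0 ≤ Ph M g p1 i n x := by
  unfold Ph
  have := Sx_le_W hM g1 hp n h
  exact add_nonneg (div_nonneg (by linarith) (by positivity)) (Finset.sum_nonneg fun m _ =>
    div_nonneg (Fx_nonneg hM _ _ _ (h.B hM hp)) (by positivity))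

lemma sum_Ph_le (hM : Stoch M) (g0 : ∀ k a, 0 ≤ g k a) (g1 : ∀ k a, g k a ≤ 1)
    {p1 : K → ℝ} (hp : IsB p1) (V : ℝ) (i n N : ℕ) (hn : 0 < n)
    (x : (K → ℝ) × (ℕ → A)) (h : Reach M p1 x) (hV : N * V - 1 ≤ Sx M g N x) :
    ∑ t ∈ Finset.range N, Ph M g p1 i n (th M t x) ≤
      N * (Wn M g p1 n / n - V + 2 * (i + 1) * i / n) + (1 + n + (i + 1) * i) := by
  have hx := h.B hM hp
  have hn' : (0:ℝ) < n := by exact_mod_cast hn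
  unfold Ph
  rw [Finset.sum_add_distrib, Finset.sum_comm]
  have h1 : ∑ t ∈ Finset.range N, (Wn M g p1 n - Sx M g n (th M t x)) / n ≤
      N * (Wn M g p1 n / n - V) + (1 + n) := by
    have := sum_Sx_ge hM g0 g1 n N x hx
    rw [← Finset.sum_div, Finset.sum_sub_distrib, div_le_iff₀ hn']
    simp only [Finset.sum_const, Finset.card_range, nsmul_eq_mul]
    have e : (N * (Wn M g p1 n / n - V) + (1 + n)) * (n:ℝ) =
      N * Wn M g p1 n - n * (N * V - 1) + n * n := by field_simp; ring
    rw [e]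
    have := mul_le_mul_of_nonneg_left hV hn'.le
    linarith
  have h2 : ∑ m ∈ Finset.range (i + 1), ∑ t ∈ Finset.range N, Fx M g m n (th M t x) / (n:ℝ) ^ 2 ≤
      ∑ m ∈ Finset.range (i + 1), (i + 2 * i / n * N : ℝ) := by
    refine Finset.sum_le_sum fun m hm => ?_
    rw [← Finset.sum_div, div_le_iff₀ (by positivity)]
    refine (sum_Fx_le hM g0 g1 m n N x hx).trans ?_
    have hm' : (m:ℝ) ≤ i := by exact_mod_cast Nat.lt_succ_iff.1 (Finset.mem_range.1 hm)
    have e : (i + 2 * i / n * N : ℝ) * n ^ 2 = i * n ^ 2 + 2 * i * n * N := by field_simp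
    rw [e]; gcongr
  simp only [Finset.sum_const, Finset.card_range, nsmul_eq_mul] at h2
  push_cast at h2
  have e : (N:ℝ) * (Wn M g p1 n / n - V + 2 * (i + 1) * i / n) + (1 + n + (i + 1) * i) =
    N * (Wn M g p1 n / n - V) + (1 + n) + (i + 1) * (i + 2 * i / n * N) := by ring
  rw [e]
  linarith

variable [TopologicalSpace A] [DiscreteTopology A]

lemma continuous_sh (m : ℕ) : Continuous (sh m : (ℕ → A) → (ℕ → A)) :=
  continuous_pi fun i => continuous_apply _

lemma continuous_Tr (m : ℕ) : Continuous (fun a : ℕ → A => Tr M a m) := by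
  induction m with
  | zero => exact continuous_const
  | succ m ih =>
    simp only [Tr]
    exact ih.matrix_mul ((continuous_of_discreteTopology (f := M)).comp (continuous_apply m))

lemma continuous_H (n : ℕ) : Continuous (fun a : ℕ → A => Hh M g n a) := by
  unfold Hh
  refine continuous_finsetSum _ fun s _ => ?_
  exact (continuous_Tr s).matrix_mulVec (continuous_pi fun k =>
    (continuous_of_discreteTopology (f := g k)).comp (continuous_apply s))

lemma continuous_Sx (n : ℕ) : Continuous (Sx M g n) := by
  unfold Sx
  exact continuous_fst.dotProduct ((continuous_H n).comp continuous_snd)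

lemma continuous_Fx (m n : ℕ) : Continuous (Fx M g m n) := by
  unfold Fx
  refine continuous_finsetSum _ fun k _ => continuous_finsetSum _ fun k' _ => ?_
  refine Continuous.mul (Continuous.mul ((continuous_apply k).comp continuous_fst) ?_) (Continuous.pow (Continuous.sub ?_ ?_) 2)
  · exact ((continuous_Tr m).comp continuous_snd).matrix_elem k k'
  · exact (continuous_apply k').comp ((continuous_H n).comp ((continuous_sh m).comp continuous_snd))
  · exact (continuous_apply k).comp ((continuous_H n).comp continuous_snd)

lemma continuous_Ph (p1 : K → ℝ) (i n : ℕ) : Continuous (Ph M g p1 i n) := by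
  unfold Ph
  exact ((continuous_const.sub (continuous_Sx n)).div_const _).add
    (continuous_finsetSum _ fun m _ => (continuous_Fx m n).div_const _)

lemma isCompact_B [Finite A] : IsCompact {x : (K → ℝ) × (ℕ → A) | IsB x.1} := by
  have : {x : (K → ℝ) × (ℕ → A) | IsB x.1} = (stdSimplex ℝ K) ×ˢ Set.univ := by
    ext x; simp [IsB, stdSimplex]
  rw [this]
  exact (isCompact_stdSimplex ℝ K).prod isCompact_univ

lemma exists_limit [Finite A] (hM : Stoch M) (g0 : ∀ k a, 0 ≤ g k a) (g1 : ∀ k a, g k a ≤ 1)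
    {p1 : K → ℝ} (hp : IsB p1) :
    ∃ V : ℝ, (∀ η > 0, ∀ᶠ n : ℕ in atTop, ∀ b, Sx M g n (p1, b) ≤ n * (V + η)) ∧
    ∃ (x : (K → ℝ) × (ℕ → A)) (n : ℕ → ℕ), IsB x.1 ∧ (∀ i, i < n i) ∧
      (∀ ε > 0, ∃ y, Reach M p1 y ∧ ∀ k, |y.1 k - x.1 k| < ε) ∧
      (∀ i, V - 2 / 2 ^ i ≤ Sx M g (n i) x / n i) ∧
      (∀ i m, m ≤ i → Fx M g m (n i) x / (n i) ^ 2 ≤ 2 / 2 ^ i) := by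
  have hsub := W_sub (g := g) hM g1 hp
  have hbdd : BddBelow (Set.range fun n => Wn M g p1 n / n) := by
    refine ⟨0, ?_⟩
    rintro _ ⟨n, rfl⟩
    refine div_nonneg ?_ (by positivity)
    obtain ⟨r, y, hy, rfl⟩ := W_nonempty (M := M) (g := g) p1 n
    exact (Sx_nonneg hM g0 n y (hy.B hM hp)).trans (Sx_le_W hM g1 hp n hy)
  set V := hsub.lim with hV
  have hlim : Tendsto (fun n => Wn M g p1 n / n) atTop (nhds V) := hsub.tendsto_lim hbdd
  refine ⟨V, ?_, ?_⟩
  · intro η hη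
    filter_upwards [hlim.eventually (gt_mem_nhds (show V < V + η by linarith)), eventually_gt_atTop 0] with n hn hn0 b
    have hn' : (0:ℝ) < n := by exact_mod_cast hn0
    rw [div_lt_iff₀ hn'] at hn
    have := Sx_le_W (g := g) hM g1 hp n (x := (p1, b)) ⟨0, b, (th_zero _).symm⟩
    linarith
  have hVle : ∀ n : ℕ, n ≠ 0 → V ≤ Wn M g p1 n / n := fun n hn => hsub.lim_le_div hbdd hn
  -- choose n i
  have hch : ∀ i : ℕ, ∃ n : ℕ, i < n ∧ Wn M g p1 n / n - V + 2 * (i + 1) * i / n ≤ 1 / 4 ^ i / 2 := by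
    intro i
    have h2 : Tendsto (fun n : ℕ => Wn M g p1 n / n - V + 2 * (i + 1) * i / n) atTop (nhds (V - V + 0)) :=
      (hlim.sub_const V).add (tendsto_const_div_atTop_nhds_zero_nat _)
    have := h2.eventually (ge_mem_nhds (show V - V + 0 < 1 / 4 ^ i / 2 by
      simp))
    exact ((eventually_gt_atTop i).and this).exists
  choose n hin hn using hch
  -- points
  have hpt : ∀ I : ℕ, ∃ y, Reach M p1 y ∧ ∀ i < I, Ph M g p1 i (n i) y ≤ 2 / 2 ^ i := by
    intro I
    have hN : ∀ᶠ N : ℕ in atTop, ∀ i ∈ Finset.range I, (1 + n i + (i + 1) * i : ℝ) ≤ N * (1 / 4 ^ i / 2) := by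
      rw [Filter.eventually_all_finset]
      intro i _
      have : Tendsto (fun N : ℕ => (N:ℝ) * (1 / 4 ^ i / 2)) atTop atTop :=
        tendsto_natCast_atTop_atTop.atTop_mul_const (by positivity)
      exact this.eventually_ge_atTop _
    obtain ⟨N, hN, hN0⟩ := (hN.and (eventually_gt_atTop 0)).exists
    have hN' : (0:ℝ) < N := by exact_mod_cast hN0
    obtain ⟨_, ⟨x, hx, rfl⟩, hxN⟩ := exists_lt_of_lt_csSup (W_nonempty (M := M) (g := g) p1 N)
      (show Wn M g p1 N - 1 < Wn M g p1 N by linarith)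
    have hxN' : N * V - 1 ≤ Sx M g N x := by
      have := hVle N hN0.ne'
      rw [le_div_iff₀ hN'] at this
      linarith
    have hsum : ∑ t ∈ Finset.range N, ∑ i ∈ Finset.range I, 2 ^ i * Ph M g p1 i (n i) (th M t x) ≤
        ∑ t ∈ Finset.range N, (2:ℝ) := by
      rw [Finset.sum_comm]
      calc _ ≤ ∑ i ∈ Finset.range I, (N:ℝ) * (1/2) ^ i := by
            refine Finset.sum_le_sum fun i hi => ?_
            rw [← Finset.mul_sum]
            have h1 := sum_Ph_le hM g0 g1 hp V i (n i) N (by have := hin i; omega) x hx hxN'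
            have h2 := hN i hi
            have h3 := mul_le_mul_of_nonneg_left (hn i) hN'.le
            have h4 : ∑ t ∈ Finset.range N, Ph M g p1 i (n i) (th M t x) ≤ N * (1 / 4 ^ i) := by linarith
            calc _ ≤ 2 ^ i * (N * (1 / 4 ^ i) : ℝ) := by gcongr
              _ = N * (1/2) ^ i := by
                rw [show (4:ℝ) = 2 * 2 by norm_num, mul_pow, _root_.one_div_pow]; field_simp
        _ ≤ N * 2 := by
            rw [← Finset.mul_sum]
            refine mul_le_mul_of_nonneg_left ?_ hN'.le
            exact sum_geometric_two_le I
        _ = _ := by simp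
    obtain ⟨t, ht, hle⟩ := Finset.exists_le_of_sum_le ⟨0, Finset.mem_range.2 hN0⟩ hsum
    refine ⟨th M t x, hx.th t, fun i hi => ?_⟩
    rw [le_div_iff₀ (by positivity), mul_comm]
    refine le_trans ?_ hle
    exact Finset.single_le_sum (f := fun i => 2 ^ i * Ph M g p1 i (n i) (th M t x))
      (fun i _ => mul_nonneg (by positivity) (Ph_nonneg hM g1 hp _ _ (hx.th t))) (Finset.mem_range.2 hi)
  choose y hyR hy using hpt
  obtain ⟨x, hxB, φ, hφ, hφx⟩ := (isCompact_B (K := K) (A := A)).tendsto_subseq (x := y)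
    (fun I => (hyR I).B hM hp)
  have hPh : ∀ i, Ph M g p1 i (n i) x ≤ 2 / 2 ^ i := by
    intro i
    refine le_of_tendsto (((continuous_Ph p1 i (n i)).tendsto x).comp hφx) ?_
    filter_upwards [eventually_gt_atTop i] with j hj
    exact hy _ i (lt_of_lt_of_le hj (hφ.id_le j))
  have hpos : ∀ i, (0:ℝ) < n i := fun i => by
    have := hin i
    exact_mod_cast (show 0 < n i by omega)
  have hW : ∀ i, Sx M g (n i) x ≤ Wn M g p1 (n i) := by
    intro i
    refine le_of_tendsto (((continuous_Sx (n i)).tendsto x).comp hφx) (Eventually.of_forall fun j => ?_)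
    exact Sx_le_W hM g1 hp _ (hyR _)
  have hF0 : ∀ i m, 0 ≤ Fx M g m (n i) x / (n i) ^ 2 := fun i m =>
    div_nonneg (Fx_nonneg hM _ _ _ hxB) (by positivity)
  refine ⟨x, n, hxB, hin, ?_, ?_, ?_⟩
  · intro ε hε
    have h1 : Tendsto (fun j => (y (φ j)).1) atTop (nhds x.1) := (continuous_fst.tendsto x).comp hφx
    rw [tendsto_pi_nhds] at h1
    have : ∀ᶠ j in atTop, ∀ k, |(y (φ j)).1 k - x.1 k| < ε := by
      rw [Filter.eventually_all]
      intro k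
      exact (Metric.tendsto_nhds.1 (h1 k)) ε hε
    obtain ⟨j, hj⟩ := this.exists
    exact ⟨_, hyR _, hj⟩
  · intro i
    have h1 := hPh i
    unfold Ph at h1
    have h2 := Finset.sum_nonneg (s := Finset.range (i+1)) fun m _ => hF0 i m
    have h3 := hVle (n i) (by have := hin i; omega)
    rw [sub_div] at h1
    linarith
  · intro i m hm
    have h1 := hPh i
    unfold Ph at h1
    have h2 := Finset.single_le_sum (s := Finset.range (i+1)) (f := fun m => Fx M g m (n i) x / (n i : ℝ) ^ 2)
      (fun m _ => hF0 i m) (Finset.mem_range.2 (Nat.lt_succ_of_le hm))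
    have h3 : 0 ≤ (Wn M g p1 (n i) - Sx M g (n i) x) / n i :=
      div_nonneg (by linarith [hW i]) (hpos i).le
    linarith

end cpt

end

section
open Matrix Topology

section matC
variable {K A : Type} [Fintype K] [DecidableEq K]
variable {M : A → Matrix K K ℝ} {g : K → A → ℝ}

lemma propC (hM : Stoch M) (g0 : ∀ k a, 0 ≤ g k a) (g1 : ∀ k a, g k a ≤ 1) (V : ℝ)
    (x : (K → ℝ) × (ℕ → A)) (n : ℕ → ℕ) (hB : IsB x.1) (hin : ∀ i, i < n i)
    (hV : ∀ i, V - 2 / 2 ^ i ≤ Sx M g (n i) x / n i)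
    (hF : ∀ i m, m ≤ i → Fx M g m (n i) x / (n i : ℝ) ^ 2 ≤ 2 / 2 ^ i) :
    ∃ c : K → ℝ, (∀ k, 0 ≤ c k ∧ c k ≤ 1) ∧ V ≤ ∑ k, x.1 k * c k ∧
      ∀ ε > 0, ∃ m1 : ℕ, 1 ≤ m1 ∧ ∃ L : ℕ, 1 ≤ L ∧
        (∀ k k', 0 < x.1 k → 0 < Tr M x.2 m1 k k' →
          (L : ℝ) * (c k - ε) ≤ Hh M g L (sh m1 x.2) k') ∧
        (∀ k k' k'', 0 < Tr M x.2 m1 k k' → 0 < Tr M (sh m1 x.2) L k' k'' →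
          0 < Tr M x.2 m1 k k'') := by
  have hn0 : ∀ i, (0:ℝ) < n i := fun i => by exact_mod_cast (Nat.zero_le i).trans_lt (hin i)
  obtain ⟨c, hc, ψ, hψ, hψc⟩ := (isCompact_univ_pi (fun _ : K => isCompact_Icc (a := (0:ℝ)) (b := 1))).tendsto_subseq
    (x := fun i k => Hh M g (n i) x.2 k / n i) (fun i k _ =>
      ⟨div_nonneg (H_nonneg hM g0 _ _ _) (hn0 i).le,
        (div_le_one (hn0 i)).2 (H_le hM g1 _ _ _)⟩)
  rw [tendsto_pi_nhds] at hψc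
  simp only [Function.comp] at hψc
  have hψt := hψ.tendsto_atTop
  have hgeo : Tendsto (fun i => (2:ℝ) / 2 ^ ψ i) atTop (𝓝 0) := by
    have h1 : Tendsto (fun i : ℕ => (2:ℝ) * (1/2) ^ i) atTop (𝓝 (2 * 0)) :=
      (tendsto_pow_atTop_nhds_zero_of_lt_one (by norm_num) (by norm_num)).const_mul 2
    have h2 := h1.comp hψt
    simp only [mul_zero] at h2
    refine h2.congr fun i => ?_
    simp only [Function.comp, _root_.one_div_pow]; ring
  have hnt : Tendsto (fun i => (n (ψ i) : ℝ)) atTop atTop := by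
    have h1 : Tendsto n atTop atTop := tendsto_atTop_mono (fun i => (hin i).le) tendsto_id
    exact tendsto_natCast_atTop_atTop.comp (h1.comp hψt)
  refine ⟨c, fun k => hc k trivial, ?_, ?_⟩
  · have h1 : Tendsto (fun i => V - 2 / 2 ^ ψ i) atTop (𝓝 (V - 0)) := tendsto_const_nhds.sub hgeo
    rw [sub_zero] at h1
    have h2 : Tendsto (fun i => ∑ k, x.1 k * (Hh M g (n (ψ i)) x.2 k / n (ψ i))) atTop
        (𝓝 (∑ k, x.1 k * c k)) :=
      tendsto_finsetSum _ fun k _ => (hψc k).const_mul _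
    refine le_of_tendsto_of_tendsto' h1 h2 fun i => (hV (ψ i)).trans_eq ?_
    simp only [Sx, dotProduct, Finset.sum_div, mul_div_assoc]
  have hlim : ∀ m k k', 0 < x.1 k → 0 < Tr M x.2 m k k' →
      Tendsto (fun i => Hh M g (n (ψ i)) (sh m x.2) k' / n (ψ i)) atTop (𝓝 (c k)) := by
    intro m k k' hk hkk
    set w := x.1 k * Tr M x.2 m k k' with hw
    have hw0 : 0 < w := mul_pos hk hkk
    set d : ℕ → ℝ := fun i => Hh M g (n (ψ i)) (sh m x.2) k' / n (ψ i) - Hh M g (n (ψ i)) x.2 k / n (ψ i) with hd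
    have hd2 : ∀ᶠ i in atTop, d i ^ 2 ≤ w⁻¹ * (2 / 2 ^ ψ i) := by
      filter_upwards [hψt.eventually_ge_atTop m] with i hi
      have h1 := hF (ψ i) m hi
      have h2 : w * (Hh M g (n (ψ i)) (sh m x.2) k' - Hh M g (n (ψ i)) x.2 k) ^ 2 ≤ Fx M g m (n (ψ i)) x := by
        refine le_trans ?_ (Finset.single_le_sum (f := fun k => ∑ k', x.1 k * Tr M x.2 m k k' * (Hh M g (n (ψ i)) (sh m x.2) k' - Hh M g (n (ψ i)) x.2 k) ^ 2) (fun k _ => Finset.sum_nonneg fun k' _ => mul_nonneg (mul_nonneg (hB.1 k) (Tr_nonneg hM _ _ _ _)) (sq_nonneg _)) (Finset.mem_univ k))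
        exact Finset.single_le_sum (f := fun k' => x.1 k * Tr M x.2 m k k' * (Hh M g (n (ψ i)) (sh m x.2) k' - Hh M g (n (ψ i)) x.2 k) ^ 2) (fun k' _ => mul_nonneg (mul_nonneg (hB.1 k) (Tr_nonneg hM _ _ _ _)) (sq_nonneg _)) (Finset.mem_univ k')
      have h3 : w * d i ^ 2 ≤ 2 / 2 ^ ψ i := by
        refine le_trans ?_ h1
        rw [le_div_iff₀ (pow_pos (hn0 _) 2)]
        refine le_trans (le_of_eq ?_) h2
        have := (hn0 (ψ i)).ne'
        simp only [hd]; field_simp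
      rw [← div_eq_inv_mul, le_div_iff₀ hw0, mul_comm]; exact h3
    have hd0 : Tendsto (fun i => d i ^ 2) atTop (𝓝 0) := by
      have h5 := hgeo.const_mul w⁻¹
      rw [mul_zero] at h5
      exact tendsto_of_tendsto_of_tendsto_of_le_of_le' tendsto_const_nhds h5
        (Eventually.of_forall fun i => sq_nonneg _) hd2
    have hd1 : Tendsto d atTop (𝓝 0) := by
      have h6 := hd0.sqrt
      rw [Real.sqrt_zero] at h6
      simp only [Real.sqrt_sq_eq_abs] at h6
      exact (tendsto_zero_iff_abs_tendsto_zero _).2 h6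
    have h7 := hd1.add (hψc k)
    rw [zero_add] at h7
    refine h7.congr fun i => ?_
    simp [hd]
  intro ε hε
  obtain ⟨R, hR⟩ := Finite.exists_infinite_fiber
    (fun (i : ℕ) (k k' : K) => (0 < Tr M x.2 (n (ψ i)) k k' : Prop))
  have hR' := Nat.frequently_atTop_iff_infinite.2 (Set.infinite_coe_iff.1 hR)
  obtain ⟨i0, hi0⟩ := hR'.exists
  set m1 := n (ψ i0) with hm1
  have hm1' : 1 ≤ m1 := by have := hin (ψ i0); omega
  have hev : ∀ᶠ i in atTop, ∀ k k', 0 < x.1 k → 0 < Tr M x.2 m1 k k' →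
      c k - ε / 2 < Hh M g (n (ψ i)) (sh m1 x.2) k' / n (ψ i) := by
    rw [eventually_all]; intro k
    rw [eventually_all]; intro k'
    by_cases hk : 0 < x.1 k ∧ 0 < Tr M x.2 m1 k k'
    · filter_upwards [(hlim m1 k k' hk.1 hk.2).eventually (lt_mem_nhds (show c k - ε / 2 < c k by linarith))] with i hi _ _ using hi
    · exact Eventually.of_forall fun i h1 h2 => absurd ⟨h1, h2⟩ hk
  obtain ⟨i, hiR, hi1, hi2⟩ := (hR'.and_eventually (hev.and
    (hnt.eventually_ge_atTop (m1 + 1 + 2 * m1 / ε)))).exists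
  have hpos : (0:ℝ) ≤ 2 * m1 / ε := by positivity
  have hge : m1 + 1 ≤ n (ψ i) := by
    have : ((m1 + 1 : ℕ) : ℝ) ≤ n (ψ i) := by push_cast; linarith
    exact_mod_cast this
  obtain ⟨L, hL⟩ := Nat.exists_eq_add_of_le hge
  refine ⟨m1, hm1', 1 + L, by omega, ?_, ?_⟩
  · intro k k' hk hkk
    have h1 := hi1 k k' hk hkk
    rw [lt_div_iff₀ (hn0 _)] at h1
    rw [show n (ψ i) = (1 + L) + m1 by omega, H_add] at h1
    have h2 := Tr_mulVec_le hM (sh m1 x.2) (1 + L) _ m1 (H_le hM g1 m1 (sh (1 + L) (sh m1 x.2))) k'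
    simp only [Pi.add_apply] at h1
    have h3 := H_nonneg hM g0 (1 + L) (sh m1 x.2) k'
    have h4 : (2 * m1 : ℝ) ≤ ((1 + L + m1 : ℕ) : ℝ) * ε := by
      rw [← div_le_iff₀ hε, show 1 + L + m1 = n (ψ i) by omega]
      linarith [(Nat.cast_nonneg m1 : (0:ℝ) ≤ m1)]
    push_cast at h1 h4 ⊢
    rcases le_total 0 (c k - ε) with h | h
    · have : 0 ≤ (m1:ℝ) * (c k - ε) := by positivity
      nlinarith
    · have : (1 + (L:ℝ)) * (c k - ε) ≤ 0 := mul_nonpos_of_nonneg_of_nonpos (by positivity) h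
      linarith
  · intro k k' k'' h1 h2
    have h3 : 0 < Tr M x.2 (n (ψ i)) k k'' := by
      rw [show n (ψ i) = m1 + (1 + L) by omega, Tr_add, Matrix.mul_apply]
      exact Finset.sum_pos' (fun j _ => mul_nonneg (Tr_nonneg hM _ _ _ _) (Tr_nonneg hM _ _ _ _))
        ⟨k', Finset.mem_univ _, mul_pos h1 h2⟩
    have e1 := congrFun (congrFun hiR k) k''
    have e2 := congrFun (congrFun hi0 k) k''
    have e3 : (0 < Tr M x.2 (n (ψ i)) k k'') = (0 < Tr M x.2 m1 k k'') := e1.trans e2.symm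
    rwa [e3] at h3

end matC

end

section
open Matrix Topology

section matD
set_option linter.unusedSectionVars false
variable {K A : Type} [Fintype K] [DecidableEq K]
variable {M : A → Matrix K K ℝ} {g : K → A → ℝ}

/-- weighted transition operator -/
noncomputable def Op (M : A → Matrix K K ℝ) : ℕ → (ℕ → K → ℝ) → (ℕ → A) → (K → ℝ) → K → ℝ
  | 0, _, _, φ => φ
  | n + 1, f, a, φ => fun k => f 0 k * ∑ k', M (a 0) k k' * Op M n (sh 1 f) (sh 1 a) φ k'

lemma Op_peel (n : ℕ) (f : ℕ → K → ℝ) (a : ℕ → A) (φ : K → ℝ) :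
    Op M (n + 1) f a φ = Op M n f a (fun k => f n k * ∑ k', M (a n) k k' * φ k') := by
  induction n generalizing f a with
  | zero => rfl
  | succ n ih =>
    rw [Op, ih]
    conv_rhs => rw [Op]
    rfl

lemma Op_add (m n : ℕ) (f : ℕ → K → ℝ) (a : ℕ → A) (φ : K → ℝ) :
    Op M (m + n) f a φ = Op M m f a (Op M n (sh m f) (sh m a) φ) := by
  induction m generalizing f a with
  | zero => rw [zero_add]; rfl
  | succ m ih =>
    rw [show m + 1 + n = (m + n) + 1 by ring, Op, ih]
    conv_rhs => rw [Op]
    simp only [sh_sh, add_comm m 1]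

lemma Op_congr (n : ℕ) (f f' : ℕ → K → ℝ) (a a' : ℕ → A) (φ : K → ℝ) (h : ∀ s < n, f s = f' s)
    (ha : ∀ s < n, a s = a' s) : Op M n f a φ = Op M n f' a' φ := by
  induction n generalizing f f' a a' with
  | zero => rfl
  | succ n ih =>
    rw [Op, Op, ih (sh 1 f) (sh 1 f') (sh 1 a) (sh 1 a') (fun s hs => h _ (by omega)) (fun s hs => ha _ (by omega)),
      h 0 (by omega), ha 0 (by omega)]

lemma Tr_succ' (a : ℕ → A) (n : ℕ) : Tr M a (n + 1) = M (a 0) * Tr M (sh 1 a) n := by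
  rw [add_comm, Tr_add]; simp [Tr]

lemma Op_one (n : ℕ) (f : ℕ → K → ℝ) (hf : ∀ s < n, ∀ k, f s k = 1) (a : ℕ → A) (φ : K → ℝ) :
    Op M n f a φ = Tr M a n *ᵥ φ := by
  induction n generalizing f a with
  | zero => simp [Op, Tr]
  | succ n ih =>
    rw [Op, ih (sh 1 f) (fun s hs k => hf _ (by omega) k), Tr_succ', ← Matrix.mulVec_mulVec]
    funext k
    rw [hf 0 (by omega), one_mul]; rfl

lemma Op_mono (hM : Stoch M) (n : ℕ) (f : ℕ → K → ℝ) (hf : ∀ s k, 0 ≤ f s k) (a : ℕ → A) (φ φ' : K → ℝ) (k : K)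
    (h : ∀ k', 0 < Tr M a n k k' → φ k' ≤ φ' k') : Op M n f a φ k ≤ Op M n f a φ' k := by
  induction n generalizing f a k with
  | zero => exact h k (by simp [Tr])
  | succ n ih =>
    rw [Op, Op]
    refine mul_le_mul_of_nonneg_left (Finset.sum_le_sum fun k' _ => ?_) (hf _ _)
    rcases (hM.nn (a 0) k k').eq_or_lt with h0 | h0
    · rw [← h0]; simp
    refine mul_le_mul_of_nonneg_left (ih (sh 1 f) (fun s k => hf _ _) (sh 1 a) k' fun k'' hk'' => h k'' ?_) h0.le
    rw [Tr_succ', Matrix.mul_apply]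
    exact Finset.sum_pos' (fun j _ => mul_nonneg (hM.nn _ _ _) (Tr_nonneg hM _ _ _ _))
        ⟨k', Finset.mem_univ _, mul_pos h0 hk''⟩

lemma Op_nonneg (hM : Stoch M) (n : ℕ) (f : ℕ → K → ℝ) (hf : ∀ s k, 0 ≤ f s k) (a : ℕ → A) (φ : K → ℝ)
    (h : ∀ k, 0 ≤ φ k) (k : K) : 0 ≤ Op M n f a φ k := by
  induction n generalizing f a k with
  | zero => exact h k
  | succ n ih =>
    rw [Op]
    exact mul_nonneg (hf _ _) (Finset.sum_nonneg fun k' _ => mul_nonneg (hM.nn _ _ _) (ih _ (fun s k => hf _ _) _ _))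

lemma Op_smul (n : ℕ) (f : ℕ → K → ℝ) (a : ℕ → A) (C : ℝ) (φ : K → ℝ) (k : K) :
    Op M n f a (fun k => C * φ k) k = C * Op M n f a φ k := by
  induction n generalizing f a k with
  | zero => rfl
  | succ n ih =>
    rw [Op, Op]
    simp only [ih, Finset.mul_sum]
    exact Finset.sum_congr rfl fun k' _ => by ring

/-- exponential factors -/
noncomputable def ef (g : K → A → ℝ) (l μ : ℝ) (a : ℕ → A) : ℕ → K → ℝ :=
  fun s k => Real.exp (-l * (g k (a s) - μ))

lemma ef_nonneg (l μ : ℝ) (a : ℕ → A) (s : ℕ) (k : K) : 0 ≤ ef g l μ a s k := (Real.exp_pos _).le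

lemma H_succ' (n : ℕ) (a : ℕ → A) (k : K) :
    Hh M g (n + 1) a k = g k (a 0) + ∑ k', M (a 0) k k' * Hh M g n (sh 1 a) k' := by
  rw [add_comm n 1, H_add]
  simp [Hh, Tr, Matrix.mulVec, dotProduct]

lemma Op_ef_zero (hM : Stoch M) (μ : ℝ) (n : ℕ) (a : ℕ → A) (k : K) :
    Op M n (ef g 0 μ a) a (fun _ => 1) k = 1 := by
  rw [Op_one n _ (fun s _ k => by simp [ef])]
  simp [Matrix.mulVec, dotProduct, Tr_row hM]

lemma Op_deriv (hM : Stoch M) (μ : ℝ) (n : ℕ) (a : ℕ → A) (k : K) :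
    HasDerivAt (fun l => Op M n (ef g l μ a) a (fun _ => 1) k) (-(Hh M g n a k - n * μ)) 0 := by
  induction n generalizing a k with
  | zero => simpa [Op, Hh] using hasDerivAt_const (0:ℝ) (1:ℝ)
  | succ n ih =>
    have h1 : HasDerivAt (fun l => ef g l μ a 0 k) (-(g k (a 0) - μ)) 0 := by
      have h2 : HasDerivAt (fun l : ℝ => -l * (g k (a 0) - μ)) (-1 * (g k (a 0) - μ)) 0 :=
        (hasDerivAt_id (0:ℝ)).neg.mul_const _
      have h3 := h2.exp
      simpa [ef] using h3
    have h2 : HasDerivAt (fun l => ∑ k', M (a 0) k k' * Op M n (ef g l μ (sh 1 a)) (sh 1 a) (fun _ => 1) k')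
        (∑ k', M (a 0) k k' * -(Hh M g n (sh 1 a) k' - n * μ)) 0 :=
      HasDerivAt.fun_sum fun k' _ => (ih (sh 1 a) k').const_mul _
    have h3 := h1.mul h2
    have e0 : ef g 0 μ a 0 k = 1 := by simp [ef]
    have e1 : ∑ k', M (a 0) k k' * Op M n (ef g 0 μ (sh 1 a)) (sh 1 a) (fun _ => 1) k' = 1 := by
      simp only [Op_ef_zero hM, mul_one, hM.row]
    rw [e0, e1] at h3
    have e2 : -(g k (a 0) - μ) * 1 + 1 * ∑ k', M (a 0) k k' * -(Hh M g n (sh 1 a) k' - n * μ) =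
        -(Hh M g (n + 1) a k - (n + 1 : ℕ) * μ) := by
      rw [H_succ']
      simp only [mul_neg, mul_sub, Finset.sum_neg_distrib, Finset.sum_sub_distrib]
      rw [← Finset.sum_mul, hM.row]
      push_cast; ring
    rw [e2] at h3
    exact h3

lemma contraction (hM : Stoch M) (μ : ℝ) (L : ℕ) (b : ℕ → A) (D : K → Prop)
    (hD : ∀ k, D k → (L:ℝ) * μ < Hh M g L b k) :
    ∃ l > 0, ∃ ρ, 0 ≤ ρ ∧ ρ < 1 ∧ ∀ k, D k → Op M L (ef g l μ b) b (fun _ => 1) k ≤ ρ := by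
  have hev : ∀ᶠ l in 𝓝[>] (0:ℝ), ∀ k, D k → Op M L (ef g l μ b) b (fun _ => 1) k < 1 := by
    rw [eventually_all]; intro k
    by_cases hk : D k
    · have h1 := Op_deriv (g := g) hM μ L b k
      have h2 : -(Hh M g L b k - L * μ) < 0 := by have := hD k hk; linarith
      have h3 := (hasDerivAt_iff_tendsto_slope.1 h1).eventually (gt_mem_nhds h2)
      have h4 : 𝓝[>] (0:ℝ) ≤ 𝓝[≠] 0 := nhdsWithin_mono _ (fun y hy => ne_of_gt hy)
      filter_upwards [h4 h3, self_mem_nhdsWithin] with l hl hl0 _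
      have hl0' : (0:ℝ) < l := hl0
      rw [slope_def_field, Op_ef_zero hM, sub_zero, div_lt_iff₀ hl0', zero_mul] at hl
      linarith
    · exact Eventually.of_forall fun l h => absurd h hk
  obtain ⟨l, hl, hl0⟩ := (hev.and self_mem_nhdsWithin).exists
  refine ⟨l, hl0, ?_⟩
  by_cases hne : ∃ k, D k
  · classical
    obtain ⟨k0, hk0⟩ := hne
    obtain ⟨k1, hk1, hmax⟩ := Finset.exists_max_image (Finset.univ.filter D)
      (fun k => Op M L (ef g l μ b) b (fun _ => 1) k) ⟨k0, by simp [hk0]⟩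
    refine ⟨_, Op_nonneg hM _ _ (ef_nonneg _ _ _) _ _ (fun _ => zero_le_one) k1, hl k1 (by simpa using hk1), fun k hk => hmax k (by simp [hk])⟩
  · exact ⟨0, le_rfl, zero_lt_one, fun k hk => absurd ⟨k, hk⟩ hne⟩

lemma Op_iter (hM : Stoch M) (l μ : ℝ) (L : ℕ) (b : ℕ → A) (hb : sh L b = b) (D : K → Prop) (ρ : ℝ)
    (h0 : 0 ≤ ρ)
    (hD : ∀ k, D k → Op M L (ef g l μ b) b (fun _ => 1) k ≤ ρ)
    (hcl : ∀ k k', D k → 0 < Tr M b L k k' → D k') (j : ℕ) (k : K) (hk : D k) :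
    Op M (j * L) (ef g l μ b) b (fun _ => 1) k ≤ ρ ^ j := by
  induction j generalizing k with
  | zero => simp [Op]
  | succ j ih =>
    rw [show (j + 1) * L = L + j * L by ring, Op_add, hb]
    have e : sh L (ef g l μ b) = ef g l μ b := by
      conv_rhs => rw [← hb]
      rfl
    rw [e]
    calc _ ≤ Op M L (ef g l μ b) b (fun k => ρ ^ j * (fun _ => 1 : K → ℝ) k) k := by
          refine Op_mono hM _ _ (ef_nonneg _ _ _) _ _ _ _ fun k' hk' => ?_
          rw [mul_one]; exact ih k' (hcl k k' hk hk')
      _ = ρ ^ j * _ := Op_smul _ _ _ _ _ _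
      _ ≤ ρ ^ j * ρ := mul_le_mul_of_nonneg_left (hD k hk) (pow_nonneg h0 j)
      _ = ρ ^ (j + 1) := (pow_succ _ _).symm

lemma Tr_congr (n : ℕ) (a b : ℕ → A) (h : ∀ i < n, a i = b i) : Tr M a n = Tr M b n := by
  induction n with
  | zero => rfl
  | succ n ih => rw [Tr, Tr, ih (fun i hi => h i (by omega)), h n (by omega)]

lemma H_congr (n : ℕ) (a b : ℕ → A) (h : ∀ i < n, a i = b i) : Hh M g n a = Hh M g n b := by
  unfold Hh
  refine Finset.sum_congr rfl fun s hs => ?_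
  have hs := Finset.mem_range.1 hs
  rw [Tr_congr s a b (fun i hi => h i (by omega)), h s hs]

end matD

end

section
open Matrix Topology ProbabilityTheory

section samp

open Classical in
lemma sampleFin_measurable {n : ℕ} (hn : 0 < n) (p : Fin n → ℝ) : Measurable (sampleFin hn p) := by
  let G : (Fin n → Prop) → Fin n := fun b =>
    if hs : (Finset.univ.filter fun y => b y).Nonempty then (Finset.univ.filter fun y => b y).min' hs else ⟨0, hn⟩
  have hX : Measurable (fun (u : ℝ) (y : Fin n) => (u < ∑ z ∈ Finset.univ.filter fun z : Fin n => z ≤ y, p z : Prop)) := by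
    refine measurable_pi_lambda _ fun y => ?_
    exact measurableSet_setOfPred.1 (measurableSet_lt measurable_id measurable_const)
  have : sampleFin hn p = G ∘ (fun (u : ℝ) (y : Fin n) => (u < ∑ z ∈ Finset.univ.filter fun z : Fin n => z ≤ y, p z : Prop)) := by
    funext u
    simp only [sampleFin, G, Function.comp]
  rw [this]
  exact (measurable_of_finite G).comp hX

open Classical in
lemma sampleFin_eq_iff {n : ℕ} (hn : 0 < n) (p : Fin n → ℝ) (hp : ∀ i, 0 ≤ p i) (hs : ∑ i, p i = 1)
    {u : ℝ} (hu : u ∈ Set.Ico (0:ℝ) 1) (i : Fin n) :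
    sampleFin hn p u = i ↔ u ∈ Set.Ico (∑ z ∈ Finset.univ.filter fun z : Fin n => z < i, p z)
      (∑ z ∈ Finset.univ.filter fun z : Fin n => z ≤ i, p z) := by
  have hne : (Finset.univ.filter fun y : Fin n => u < ∑ z ∈ Finset.univ.filter fun z : Fin n => z ≤ y, p z).Nonempty := by
    refine ⟨⟨n - 1, by omega⟩, ?_⟩
    simp only [Finset.mem_filter, Finset.mem_univ, true_and]
    rw [Finset.filter_true_of_mem (fun z _ => by rw [Fin.le_def]; simp only; omega), hs]
    exact hu.2
  simp only [sampleFin]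
  rw [dif_pos hne, Finset.min'_eq_iff]
  simp only [Finset.mem_filter, Finset.mem_univ, true_and, Set.mem_Ico]
  rw [and_comm]
  refine and_congr_left fun _ => ⟨fun h => ?_, fun h b hb => ?_⟩
  · rcases Nat.eq_zero_or_pos i.1 with h0 | h0
    · rw [Finset.filter_false_of_mem (fun z _ => by rw [Fin.lt_def]; omega)]
      simpa using hu.1
    · by_contra hcon
      push Not at hcon
      have := h ⟨i.1 - 1, by omega⟩ (by
        refine hcon.trans_eq (Finset.sum_congr ?_ fun _ _ => rfl)
        ext z; simp only [Finset.mem_filter, Finset.mem_univ, true_and, Fin.lt_def, Fin.le_def]; omega)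
      rw [Fin.le_def] at this; simp only at this; omega
  · by_contra hcon
    push Not at hcon
    refine absurd (hb.trans_le ?_) (not_lt.2 h)
    refine Finset.sum_le_sum_of_subset_of_nonneg ?_ fun _ _ _ => hp _
    intro z; simp only [Finset.mem_filter, Finset.mem_univ, true_and]
    exact fun hz => hz.trans_lt hcon

lemma sampleFin_law {n : ℕ} (hn : 0 < n) (p : Fin n → ℝ) (hp : ∀ i, 0 ≤ p i) (hs : ∑ i, p i = 1) (i : Fin n) :
    lam.real (sampleFin hn p ⁻¹' {i}) = p i := by
  classical
  have hm := sampleFin_measurable hn p (measurableSet_singleton i)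
  rw [measureReal_restrict_apply hm]
  have e : sampleFin hn p ⁻¹' {i} ∩ Set.Ico 0 1 = Set.Ico (∑ z ∈ Finset.univ.filter fun z : Fin n => z < i, p z)
      (∑ z ∈ Finset.univ.filter fun z : Fin n => z ≤ i, p z) := by
    ext u
    constructor
    · rintro ⟨h1, h2⟩; exact (sampleFin_eq_iff hn p hp hs h2 i).1 h1
    · intro h
      have hu : u ∈ Set.Ico (0:ℝ) 1 := ⟨(Finset.sum_nonneg fun _ _ => hp _).trans h.1, h.2.trans_le (by
        rw [← hs]
        exact Finset.sum_le_sum_of_subset_of_nonneg (Finset.subset_univ _) fun _ _ _ => hp _)⟩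
      exact ⟨(sampleFin_eq_iff hn p hp hs hu i).2 h, hu⟩
  have e2 : ∑ z ∈ Finset.univ.filter (fun z : Fin n => z ≤ i), p z = (∑ z ∈ Finset.univ.filter fun z : Fin n => z < i, p z) + p i := by
    rw [show (Finset.univ.filter (fun z : Fin n => z ≤ i)) = insert i (Finset.univ.filter fun z : Fin n => z < i) by
      ext z; simp only [Finset.mem_filter, Finset.mem_univ, true_and, Finset.mem_insert]; exact le_iff_eq_or_lt]
    rw [Finset.sum_insert (by simp), add_comm]
  rw [e, Real.volume_real_Ico, e2]
  simp [hp]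

lemma sampleOn_measurable {β : Type*} [Fintype β] [Nonempty β] [MeasurableSpace β] (p : β → ℝ) :
    Measurable (sampleOn p) :=
  (measurable_of_finite _).comp (sampleFin_measurable _ _)

lemma sampleOn_integral {β : Type*} [Fintype β] [Nonempty β] (p : β → ℝ)
    (hp : ∀ i, 0 ≤ p i) (hs : ∑ i, p i = 1) (φ : β → ℝ) :
    ∫ u, φ (sampleOn p u) ∂lam = ∑ y, p y * φ y := by
  set e := Fintype.equivFin β
  have hm := sampleFin_measurable Fintype.card_pos (fun i => p (e.symm i))
  have h1 : ∫ u, φ (sampleOn p u) ∂lam =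
      ∫ i, φ (e.symm i) ∂(lam.map (sampleFin Fintype.card_pos (fun i => p (e.symm i)))) := by
    rw [integral_map hm.aemeasurable (measurable_of_finite _).aestronglyMeasurable]; rfl
  have : IsProbabilityMeasure (lam.map (sampleFin Fintype.card_pos (fun i => p (e.symm i)))) :=
    Measure.isProbabilityMeasure_map hm.aemeasurable
  rw [h1, integral_fintype Integrable.of_finite, ← e.symm.sum_comp]
  refine Finset.sum_congr rfl fun i _ => ?_
  rw [map_measureReal_apply hm (measurableSet_singleton i), sampleFin_law _ _ (fun i => hp _)
    (by rw [e.symm.sum_comp p, hs]), smul_eq_mul]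

end samp

end

section
open Matrix Topology ProbabilityTheory

section proc
variable (Γ : POMDP)

/-- transition matrix on states -/
noncomputable def MM (a : Γ.A) : Matrix Γ.K Γ.K ℝ := fun k k' => ∑ s, Γ.q k a (k', s)

lemma MM_stoch : Stoch (MM Γ) where
  nn a k k' := Finset.sum_nonneg fun s _ => Γ.q_nonneg _ _ _
  row a k := by
    rw [← Γ.q_sum k a, Fintype.sum_prod_type]; rfl

/-- state process as a function of the sequence of uniforms -/
noncomputable def stS (as : ℕ → Γ.A) (k0 : Γ.K) (u : ℕ → ℝ) : ℕ → Γ.K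
  | 0 => k0
  | m + 1 => (sampleOn (Γ.q (stS as k0 u m) (as m)) (u m)).1

lemma stS_congr (as : ℕ → Γ.A) (k0 : Γ.K) (u u' : ℕ → ℝ) (n : ℕ) (h : ∀ i < n, u i = u' i) :
    stS Γ as k0 u n = stS Γ as k0 u' n := by
  induction n with
  | zero => rfl
  | succ n ih => rw [stS, stS, ih (fun i hi => h i (by omega)), h n (by omega)]

lemma stS_measurable (as : ℕ → Γ.A) (k0 : Γ.K) (n : ℕ) : Measurable (fun u => stS Γ as k0 u n) := by
  induction n with
  | zero => exact measurable_const
  | succ n ih =>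
    have h : Measurable (fun x : Γ.K × ℝ => (sampleOn (Γ.q x.1 (as n)) x.2).1) :=
      measurable_from_prod_countable_right fun k => by
        have h1 : Measurable (sampleOn (Γ.q k (as n))) := sampleOn_measurable _
        exact h1.fst
    have h2 : Measurable (fun u : ℕ → ℝ => ((stS Γ as k0 u n, u n) : Γ.K × ℝ)) :=
      ih.prodMk (measurable_pi_apply n)
    have h3 := h.comp h2
    simp only [stS]
    exact h3

/-- product functional -/
noncomputable def Pf (f : ℕ → Γ.K → ℝ) (n : ℕ) (φ : Γ.K → ℝ) (st : ℕ → Γ.K) : ℝ :=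
  (∏ s ∈ Finset.range n, f s (st s)) * φ (st n)

lemma Pf_bound (f : ℕ → Γ.K → ℝ) (n : ℕ) (φ : Γ.K → ℝ) :
    ∃ C, ∀ st, ‖Pf Γ f n φ st‖ ≤ C := by
  refine ⟨(∏ s ∈ Finset.range n, ∑ k, |f s k|) * ∑ k, |φ k|, fun st => ?_⟩
  rw [Pf, Real.norm_eq_abs, abs_mul, Finset.abs_prod]
  have h : ∀ (ψ : Γ.K → ℝ) k, |ψ k| ≤ ∑ k, |ψ k| := fun ψ k =>
    Finset.single_le_sum (f := fun k => |ψ k|) (fun _ _ => abs_nonneg _) (Finset.mem_univ k)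
  refine mul_le_mul (Finset.prod_le_prod (fun _ _ => abs_nonneg _) fun s _ => h (f s) _) (h φ _) (abs_nonneg _) ?_
  exact Finset.prod_nonneg fun s _ => Finset.sum_nonneg fun _ _ => abs_nonneg _

lemma Pf_measurable {Ω : Type*} [MeasurableSpace Ω] (f : ℕ → Γ.K → ℝ) (n : ℕ) (φ : Γ.K → ℝ) (st : Ω → ℕ → Γ.K)
    (h : ∀ n, Measurable (fun ω => st ω n)) : Measurable (fun ω => Pf Γ f n φ (st ω)) := by
  unfold Pf
  refine Measurable.mul ?_ ((measurable_of_finite φ).comp (h n))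
  exact Finset.measurable_prod _ fun s _ => (measurable_of_finite (f s)).comp (h s)

noncomputable abbrev PI : Measure (ℕ → ℝ) := Measure.infinitePi (fun _ : ℕ => lam)

lemma law_unif' : lam.map (fun x m => unif x m) = PI := law_unif

lemma indep_step (n : ℕ) (F : (ℕ → ℝ) → ℝ) (hF : Measurable F)
    (hdep : ∀ u u' : ℕ → ℝ, (∀ i < n, u i = u' i) → F u = F u') (ψ : ℝ → ℝ) (hψ : Measurable ψ) :
    ∫ u, F u * ψ (u n) ∂PI = (∫ u, F u ∂PI) * ∫ x, ψ x ∂lam := by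
  have hi : iIndepFun (fun (i : ℕ) (ω : ℕ → ℝ) => ω i) PI :=
    iIndepFun_infinitePi (X := fun _ x => x) (fun _ => measurable_id)
  have h1 := hi.indepFun_finset (Finset.range n) {n} (by simp) (fun i => measurable_pi_apply i)
  let ext : (Finset.range n → ℝ) → (ℕ → ℝ) := fun v i => if h : i ∈ Finset.range n then v ⟨i, h⟩ else 0
  have hext : Measurable ext := by
    refine measurable_pi_lambda _ fun i => ?_
    by_cases h : i ∈ Finset.range n
    · simp only [ext, h, dif_pos]; exact measurable_pi_apply _
    · simp only [ext, h, dif_neg, not_false_eq_true]; exact measurable_const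
  have hΨ : Measurable (fun w : ({n} : Finset ℕ) → ℝ => ψ (w ⟨n, by simp⟩)) :=
    hψ.comp (measurable_pi_apply (X := fun _ : ({n} : Finset ℕ) => ℝ) ⟨n, by simp⟩)
  have h2 := h1.comp (hF.comp hext) hΨ
  have e1 : ((F ∘ ext) ∘ fun (a : ℕ → ℝ) (i : Finset.range n) => a i) = F := by
    funext u
    refine hdep _ _ fun i hi => ?_
    simp [ext, hi]
  have e2 : ((fun w : ({n} : Finset ℕ) → ℝ => ψ (w ⟨n, by simp⟩)) ∘ fun (a : ℕ → ℝ) i => a i) = fun u => ψ (u n) := rfl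
  rw [e1, e2] at h2
  rw [h2.integral_fun_mul_eq_mul_integral hF.aestronglyMeasurable
    (hψ.comp (measurable_pi_apply n)).aestronglyMeasurable]
  congr 1
  have e3 : PI.map (fun u => u n) = lam := Measure.infinitePi_map_eval _ n
  rw [← e3, integral_map (measurable_pi_apply n).aemeasurable hψ.aestronglyMeasurable]

lemma key_formula_seq (as : ℕ → Γ.A) (k0 : Γ.K) (f : ℕ → Γ.K → ℝ) (n : ℕ) (φ : Γ.K → ℝ) :
    ∫ u, Pf Γ f n φ (stS Γ as k0 u) ∂PI = Op (MM Γ) n f as φ k0 := by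
  induction n generalizing φ with
  | zero => simp [Pf, stS, Op]
  | succ n ih =>
    rw [Op_peel, ← ih]
    set R : Γ.K → ℝ := fun k => ∑ k', MM Γ (as n) k k' * φ k' with hR
    have hint : ∀ φ, Integrable (fun u => Pf Γ f n φ (stS Γ as k0 u)) PI := fun φ => by
      obtain ⟨C, hC⟩ := Pf_bound Γ f n φ
      exact Integrable.of_bound (Pf_measurable Γ f n φ _ (stS_measurable Γ as k0)).aestronglyMeasurable C
        (Eventually.of_forall fun u => hC _)
    set ind : Γ.K → Γ.K → ℝ := fun k k' => if k' = k then f n k else 0 with hind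
    have e1 : ∀ u, Pf Γ f (n + 1) φ (stS Γ as k0 u) =
        ∑ k, Pf Γ f n (ind k) (stS Γ as k0 u) * φ (sampleOn (Γ.q k (as n)) (u n)).1 := by
      intro u
      simp only [Pf, hind]
      rw [Finset.sum_eq_single (stS Γ as k0 u n)]
      · rw [if_pos rfl, Finset.prod_range_succ, stS]
      · intro b _ hb; rw [if_neg hb.symm]; simp
      · simp
    have e2 : ∀ u, Pf Γ f n (fun k => f n k * R k) (stS Γ as k0 u) =
        ∑ k, Pf Γ f n (ind k) (stS Γ as k0 u) * R k := by
      intro u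
      simp only [Pf, hind]
      rw [Finset.sum_eq_single (stS Γ as k0 u n)]
      · rw [if_pos rfl, mul_assoc]
      · intro b _ hb; rw [if_neg hb.symm]; simp
      · simp
    have hR' : ∀ k, ∫ x, φ (sampleOn (Γ.q k (as n)) x).1 ∂lam = R k := by
      intro k
      rw [sampleOn_integral _ (Γ.q_nonneg k _) (Γ.q_sum k _) (fun y => φ y.1), Fintype.sum_prod_type]
      simp only [hR, MM, Finset.sum_mul]
    change _ = ∫ u, Pf Γ f n (fun k => f n k * R k) (stS Γ as k0 u) ∂PI
    simp only [e1, e2]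
    rw [integral_finsetSum, integral_finsetSum]
    · refine Finset.sum_congr rfl fun k _ => ?_
      rw [indep_step n (fun u => Pf Γ f n (ind k) (stS Γ as k0 u)) (Pf_measurable Γ f n _ _ (stS_measurable Γ as k0)) _
        (fun x => φ (sampleOn (Γ.q k (as n)) x).1)
        ((measurable_of_finite (fun y : Γ.K × Γ.S => φ y.1)).comp (sampleOn_measurable _)), hR', integral_mul_const]
      intro u u' h
      simp only [Pf]
      rw [stS_congr Γ as k0 u u' n h]
      congr 1
      refine Finset.prod_congr rfl fun s hs => ?_
      rw [stS_congr Γ as k0 u u' s (fun i hi => h i (by have := Finset.mem_range.1 hs; omega))]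
    · exact fun k _ => (hint _).mul_const _
    · intro k _
      obtain ⟨C, hC⟩ := Pf_bound Γ f n (ind k)
      refine Integrable.of_bound ?_ (C * ∑ k, |φ k|) (Eventually.of_forall fun u => ?_)
      · refine ((Pf_measurable Γ f n _ _ (stS_measurable Γ as k0)).mul ?_).aestronglyMeasurable
        exact ((measurable_of_finite (fun y : Γ.K × Γ.S => φ y.1)).comp (sampleOn_measurable _)).comp (measurable_pi_apply n)
      · rw [norm_mul]
        refine mul_le_mul (hC _) ?_ (norm_nonneg _) ((norm_nonneg _).trans (hC (fun _ => k0)))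
        exact Finset.single_le_sum (f := fun k => |φ k|) (fun _ _ => abs_nonneg _) (Finset.mem_univ _)

lemma hist_length (σ : Γ.Strategy) (ω : Γ.Env) (m : ℕ) : (Γ.traj σ ω m).2.length = m := by
  induction m with
  | zero => rfl
  | succ m ih => simp [POMDP.traj, ih]

lemma act_blind (as : ℕ → Γ.A) (ω : Γ.Env) (m : ℕ) : Γ.act (Γ.blindStrat as) ω m = as m := by
  simp only [POMDP.act, POMDP.blindStrat, POMDP.hist, hist_length]

lemma state_blind (as : ℕ → Γ.A) (ω : Γ.Env) (m : ℕ) :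
    Γ.state (Γ.blindStrat as) ω m = stS Γ as ω.1 (fun i => unif ω.2 i) m := by
  induction m with
  | zero => rfl
  | succ m ih =>
    simp only [POMDP.state] at ih
    simp only [stS, POMDP.state, POMDP.traj, ← ih, POMDP.blindStrat, hist_length]

lemma measurable_unifs : Measurable (fun x m => unif x m) := measurable_pi_lambda _ measurable_unif

lemma state_measurable (as : ℕ → Γ.A) (m : ℕ) : Measurable (fun ω => Γ.state (Γ.blindStrat as) ω m) := by
  simp only [state_blind]
  exact measurable_from_prod_countable_right fun k => (stS_measurable Γ as k m).comp measurable_unifs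

variable {Γ} in
lemma vec_prob {p1 : Γ.K → ℝ} (hp : IsB p1) : IsProbabilityMeasure (vecMeasure p1) := ⟨by
  simp only [vecMeasure, Measure.coe_finsetSum, Finset.sum_apply, Measure.smul_apply, measure_univ, smul_eq_mul, mul_one]
  rw [← ENNReal.ofReal_sum_of_nonneg (fun i _ => hp.1 i), hp.2, ENNReal.ofReal_one]⟩

variable {Γ} in
lemma env_prob {p1 : Γ.K → ℝ} (hp : IsB p1) : IsProbabilityMeasure (Γ.envMeasure p1) := by
  have := vec_prob hp
  unfold POMDP.envMeasure; infer_instance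

lemma key_formula {p1 : Γ.K → ℝ} (hp : IsB p1) (as : ℕ → Γ.A) (f : ℕ → Γ.K → ℝ) (n : ℕ) (φ : Γ.K → ℝ) :
    ∫ ω, Pf Γ f n φ (Γ.state (Γ.blindStrat as) ω) ∂(Γ.envMeasure p1) = p1 ⬝ᵥ Op (MM Γ) n f as φ := by
  have := vec_prob hp
  have := env_prob hp
  obtain ⟨C, hC⟩ := Pf_bound Γ f n φ
  have hint : Integrable (fun ω => Pf Γ f n φ (Γ.state (Γ.blindStrat as) ω)) (Γ.envMeasure p1) :=
    Integrable.of_bound (Pf_measurable Γ f n φ _ (state_measurable Γ as)).aestronglyMeasurable C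
        (Eventually.of_forall fun u => hC _)
  rw [POMDP.envMeasure, integral_prod _ hint]
  have e : ∀ k, ∫ x, Pf Γ f n φ (Γ.state (Γ.blindStrat as) (k, x)) ∂lam = Op (MM Γ) n f as φ k := by
    intro k
    rw [← key_formula_seq, ← law_unif', integral_map measurable_unifs.aemeasurable
      (Pf_measurable Γ f n φ _ (stS_measurable Γ as k)).aestronglyMeasurable]
    refine integral_congr_ae (Eventually.of_forall fun x => ?_)
    simp only
    congr 1
    funext m
    rw [state_blind]
  change ∫ k, ∫ x, Pf Γ f n φ (Γ.state (Γ.blindStrat as) (k, x)) ∂lam ∂vecMeasure p1 = _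
  simp only [e]
  rw [vecMeasure, integral_finsetSum_measure]
  · simp only [integral_smul_measure, integral_dirac, dotProduct, smul_eq_mul]
    refine Finset.sum_congr rfl fun k _ => ?_
    rw [ENNReal.toReal_ofReal (hp.1 k)]
  · intro i _
    exact Integrable.smul_measure Integrable.of_finite ENNReal.ofReal_ne_top

end proc

end

section
open Matrix Topology ProbabilityTheory

section upper
variable (Γ : POMDP)

lemma rew_blind (as : ℕ → Γ.A) (ω : Γ.Env) (m : ℕ) :
    Γ.rew (Γ.blindStrat as) ω m = Γ.g (Γ.state (Γ.blindStrat as) ω m) (as m) := by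
  rw [POMDP.rew, act_blind]

lemma rew_measurable (as : ℕ → Γ.A) (m : ℕ) : Measurable (fun ω => Γ.rew (Γ.blindStrat as) ω m) := by
  simp only [rew_blind]
  exact (measurable_of_finite (fun k => Γ.g k (as m))).comp (state_measurable Γ as m)

lemma avg_measurable (as : ℕ → Γ.A) (n : ℕ) : Measurable (fun ω => Γ.avg (Γ.blindStrat as) ω n) := by
  unfold POMDP.avg
  exact (Finset.measurable_sum _ fun m _ => rew_measurable Γ as m).const_mul _

lemma avg_nonneg (σ : Γ.Strategy) (ω : Γ.Env) (n : ℕ) : 0 ≤ Γ.avg σ ω n :=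
  mul_nonneg (by positivity) (Finset.sum_nonneg fun _ _ => Γ.g_nonneg _ _)

lemma avg_le_one (σ : Γ.Strategy) (ω : Γ.Env) (n : ℕ) : Γ.avg σ ω n ≤ 1 := by
  have h : ∑ m ∈ Finset.range n, Γ.rew σ ω m ≤ n := by
    calc _ ≤ ∑ m ∈ Finset.range n, (1:ℝ) := Finset.sum_le_sum fun _ _ => Γ.g_le_one _ _
      _ = n := by simp
  unfold POMDP.avg
  rcases Nat.eq_zero_or_pos n with h0 | h0
  · subst h0; simp
  · rw [one_div, ← div_eq_inv_mul, div_le_one (by exact_mod_cast h0)]; exact h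

lemma bdd1 (σ : Γ.Strategy) (ω : Γ.Env) : IsBoundedUnder (· ≥ ·) atTop (Γ.avg σ ω) :=
  isBoundedUnder_of ⟨0, avg_nonneg Γ σ ω⟩

lemma bdd2 (σ : Γ.Strategy) (ω : Γ.Env) : IsCoboundedUnder (· ≥ ·) atTop (Γ.avg σ ω) :=
  (isBoundedUnder_of ⟨1, avg_le_one Γ σ ω⟩ : IsBoundedUnder (· ≤ ·) atTop (Γ.avg σ ω)).isCoboundedUnder_ge

lemma lim_nonneg (σ : Γ.Strategy) (ω : Γ.Env) : 0 ≤ atTop.liminf (Γ.avg σ ω) :=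
  le_liminf_of_le (bdd2 Γ σ ω) (Eventually.of_forall (avg_nonneg Γ σ ω))

lemma lim_le_one (σ : Γ.Strategy) (ω : Γ.Env) : atTop.liminf (Γ.avg σ ω) ≤ 1 :=
  liminf_le_of_frequently_le (Frequently.of_forall (avg_le_one Γ σ ω)) (bdd1 Γ σ ω)

lemma lim_measurable (as : ℕ → Γ.A) : Measurable (fun ω => atTop.liminf (Γ.avg (Γ.blindStrat as) ω)) :=
  Measurable.liminf (fun n => avg_measurable Γ as n)

lemma lim_integrable {p1 : Γ.K → ℝ} (hp : IsB p1) (as : ℕ → Γ.A) :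
    Integrable (fun ω => atTop.liminf (Γ.avg (Γ.blindStrat as) ω)) (Γ.envMeasure p1) := by
  have := env_prob hp
  refine Integrable.of_bound (lim_measurable Γ as).aestronglyMeasurable 1 (Eventually.of_forall fun ω => ?_)
  rw [Real.norm_eq_abs, abs_of_nonneg (lim_nonneg Γ _ _)]
  exact lim_le_one Γ _ _

lemma state_integral {p1 : Γ.K → ℝ} (hp : IsB p1) (as : ℕ → Γ.A) (m : ℕ) (φ : Γ.K → ℝ) :
    ∫ ω, φ (Γ.state (Γ.blindStrat as) ω m) ∂(Γ.envMeasure p1) = p1 ⬝ᵥ (Tr (MM Γ) as m *ᵥ φ) := by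
  have h := key_formula Γ hp as (fun _ _ => 1) m φ
  rw [Op_one m _ (fun _ _ _ => rfl)] at h
  simpa [Pf] using h

lemma state_integrable {p1 : Γ.K → ℝ} (hp : IsB p1) (as : ℕ → Γ.A) (m : ℕ) (φ : Γ.K → ℝ) :
    Integrable (fun ω => φ (Γ.state (Γ.blindStrat as) ω m)) (Γ.envMeasure p1) := by
  have := env_prob hp
  refine Integrable.of_bound ((measurable_of_finite φ).comp (state_measurable Γ as m)).aestronglyMeasurable
    (∑ k, |φ k|) (Eventually.of_forall fun ω => ?_)
  exact Finset.single_le_sum (f := fun k => |φ k|) (fun _ _ => abs_nonneg _) (Finset.mem_univ _)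

lemma avg_integral {p1 : Γ.K → ℝ} (hp : IsB p1) (as : ℕ → Γ.A) (n : ℕ) :
    ∫ ω, Γ.avg (Γ.blindStrat as) ω n ∂(Γ.envMeasure p1) = 1 / n * Sx (MM Γ) Γ.g n (p1, as) := by
  unfold POMDP.avg
  rw [integral_const_mul]
  simp only [rew_blind]
  rw [integral_finsetSum]
  · simp only [Sx, Hh, dotProduct_sum]
    congr 1
    exact Finset.sum_congr rfl fun i _ => state_integral Γ hp as i (fun k => Γ.g k (as i))
  · exact fun m _ => state_integrable Γ hp as m (fun k => Γ.g k (as m))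

lemma avg_integrable {p1 : Γ.K → ℝ} (hp : IsB p1) (as : ℕ → Γ.A) (n : ℕ) :
    Integrable (fun ω => Γ.avg (Γ.blindStrat as) ω n) (Γ.envMeasure p1) := by
  have := env_prob hp
  refine Integrable.of_bound (avg_measurable Γ as n).aestronglyMeasurable 1 (Eventually.of_forall fun ω => ?_)
  rw [Real.norm_eq_abs, abs_of_nonneg (avg_nonneg Γ _ _ _)]
  exact avg_le_one Γ _ _ _

lemma pay_upper {p1 : Γ.K → ℝ} (hp : IsB p1) (as : ℕ → Γ.A) (V : ℝ)
    (hV : ∀ η > 0, ∀ᶠ n : ℕ in atTop, ∀ b, Sx (MM Γ) Γ.g n (p1, b) ≤ n * (V + η)) :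
    Γ.pay p1 (Γ.blindStrat as) ≤ V := by
  have := env_prob hp
  set σ := Γ.blindStrat as
  have hlim : Tendsto (fun n => ∫ ω, min (Γ.avg σ ω n) (atTop.liminf (Γ.avg σ ω)) ∂(Γ.envMeasure p1)) atTop
      (𝓝 (∫ ω, atTop.liminf (Γ.avg σ ω) ∂(Γ.envMeasure p1))) := by
    refine tendsto_integral_of_dominated_convergence (fun _ => 1) (fun n =>
      ((avg_measurable Γ as n).min (lim_measurable Γ as)).aestronglyMeasurable) (integrable_const _) ?_ ?_
    · intro n
      refine Eventually.of_forall fun ω => ?_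
      rw [Real.norm_eq_abs, abs_of_nonneg (le_min (avg_nonneg Γ _ _ _) (lim_nonneg Γ _ _))]
      exact (min_le_left _ _).trans (avg_le_one Γ _ _ _)
    · refine Eventually.of_forall fun ω => ?_
      rw [Metric.tendsto_atTop']
      intro ε hε
      have h1 := eventually_lt_of_lt_liminf (show atTop.liminf (Γ.avg σ ω) - ε < atTop.liminf (Γ.avg σ ω) by linarith)
        (bdd1 Γ σ ω)
      obtain ⟨N, hN⟩ := eventually_atTop.1 h1
      refine ⟨N, fun n hn => ?_⟩
      have h2 := hN n hn.le
      rw [Real.dist_eq, abs_lt]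
      constructor
      · have := lt_min h2 (show atTop.liminf (Γ.avg σ ω) - ε < atTop.liminf (Γ.avg σ ω) by linarith)
        linarith
      · have := min_le_right (Γ.avg σ ω n) (atTop.liminf (Γ.avg σ ω))
        linarith
  refine le_of_forall_pos_le_add fun η hη => ?_
  refine le_of_tendsto hlim ?_
  filter_upwards [hV η hη, eventually_gt_atTop 0] with n hn hn0
  have hn0' : (0:ℝ) < n := by exact_mod_cast hn0
  calc _ ≤ ∫ ω, Γ.avg σ ω n ∂(Γ.envMeasure p1) := by
        refine integral_mono ?_ (avg_integrable Γ hp as n) fun ω => min_le_left _ _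
        exact (avg_integrable Γ hp as n).inf (lim_integrable Γ hp as)
    _ = 1 / n * Sx (MM Γ) Γ.g n (p1, as) := avg_integral Γ hp as n
    _ ≤ V + η := by
      rw [one_div, ← div_eq_inv_mul, div_le_iff₀ hn0', mul_comm]; exact hn as

end upper

end

section
open Matrix Topology ProbabilityTheory

section lower

lemma Op_le_const {K A : Type} [Fintype K] {M : A → Matrix K K ℝ} (hM : Stoch M) (n : ℕ) (f : ℕ → K → ℝ)
    (hf : ∀ s < n, ∀ k, 0 ≤ f s k ∧ f s k ≤ 1) (a : ℕ → A) (φ : K → ℝ) (C : ℝ) (hC : 0 ≤ C)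
    (h : ∀ k, φ k ≤ C) (k : K) : Op M n f a φ k ≤ C := by
  induction n generalizing f a k with
  | zero => exact h k
  | succ n ih =>
    rw [Op]
    have h1 : ∑ k', M (a 0) k k' * Op M n (sh 1 f) (sh 1 a) φ k' ≤ C := by
      calc _ ≤ ∑ k', M (a 0) k k' * C := Finset.sum_le_sum fun k' _ =>
            mul_le_mul_of_nonneg_left (ih _ (fun s hs k => hf _ (by omega) k) _ _) (hM.nn _ _ _)
        _ = C := by rw [← Finset.sum_mul, hM.row, one_mul]
    have h2 := hf 0 (by omega) k
    nlinarith

lemma liminf_ge (r : ℕ → ℝ) (h0 : ∀ i, 0 ≤ r i) (T L : ℕ) (hL : 1 ≤ L) (μ : ℝ)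
    (h : ∀ᶠ j : ℕ in atTop, 0 < ∑ s ∈ Finset.range (j * L), (r (T + s) - μ)) :
    ∀ δ > 0, ∀ᶠ n : ℕ in atTop, μ - δ ≤ (1 / n : ℝ) * ∑ m ∈ Finset.range n, r m := by
  intro δ hδ
  obtain ⟨J, hJ⟩ := eventually_atTop.1 h
  filter_upwards [eventually_ge_atTop (T + J * L + 1), tendsto_natCast_atTop_atTop.eventually_ge_atTop ((T + L) * |μ| / δ)] with n hn hn2
  have hn0 : (0:ℝ) < n := by exact_mod_cast (by omega : 0 < n)
  rw [one_div, ← div_eq_inv_mul, le_div_iff₀ hn0]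
  set j := (n - T) / L with hj
  have hjJ : J ≤ j := by
    rw [hj, Nat.le_div_iff_mul_le (by omega)]; omega
  have h1 : T + j * L ≤ n := by
    have := Nat.div_mul_le_self (n - T) L
    rw [← hj] at this
    omega
  have h2 : n < T + j * L + L := by
    have h3 := Nat.div_add_mod (n - T) L
    have h4 := Nat.mod_lt (n - T) (show 0 < L by omega)
    rw [← hj, mul_comm] at h3
    omega
  have h5 := hJ j hjJ
  rw [Finset.sum_sub_distrib] at h5
  simp only [Finset.sum_const, Finset.card_range, nsmul_eq_mul] at h5
  have h6 : ∑ s ∈ Finset.range (j * L), r (T + s) ≤ ∑ m ∈ Finset.range n, r m := by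
    calc _ ≤ ∑ m ∈ Finset.range (T + j * L), r m := by
          rw [Finset.sum_range_add]
          have := Finset.sum_nonneg (fun i (_ : i ∈ Finset.range T) => h0 i)
          linarith
      _ ≤ _ := Finset.sum_le_sum_of_subset_of_nonneg (by
          intro i; simp only [Finset.mem_range]; omega) fun i _ _ => h0 i
  have h7 : ((T:ℝ) + L) * |μ| ≤ n * δ := by rwa [div_le_iff₀ hδ] at hn2
  have h1' : ((T:ℝ) + (j * L : ℕ)) ≤ n := by exact_mod_cast h1
  have h2' : (n:ℝ) ≤ T + (j * L : ℕ) + L := by exact_mod_cast h2.le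
  have h8 : (n - (j * L : ℕ) : ℝ) * μ ≤ (T + L) * |μ| :=
    calc (n - (j * L : ℕ) : ℝ) * μ ≤ (n - (j * L : ℕ) : ℝ) * |μ| :=
          mul_le_mul_of_nonneg_left (le_abs_self μ) (by have : (0:ℝ) ≤ T := by positivity
                                                        linarith)
      _ ≤ _ := mul_le_mul_of_nonneg_right (by linarith) (abs_nonneg μ)
  nlinarith

variable (Γ : POMDP)

/-- the eventually periodic sequence -/
def pseq {A : Type} (m0 m1 L : ℕ) (b a : ℕ → A) : ℕ → A := fun i =>
  if i < m0 then b i else if i < m0 + m1 then a (i - m0) else a (m1 + (i - m0 - m1) % L)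

lemma pseq_per {A : Type} (m0 m1 L : ℕ) (hL : 1 ≤ L) (b a : ℕ → A) : EventuallyPeriodic (pseq m0 m1 L b a) := by
  refine ⟨L, hL, m0 + m1 + 1, by omega, fun m hm => ?_⟩
  simp only [pseq]
  rw [if_neg (by omega), if_neg (by omega), if_neg (by omega), if_neg (by omega),
    show m + L - m0 - m1 = m - m0 - m1 + L by omega, Nat.add_mod_right]

lemma pseq_ae {p1 : Γ.K → ℝ} (hp : IsB p1) (m0 m1 L : ℕ) (hm1 : 1 ≤ m1) (hL : 1 ≤ L) (b a : ℕ → Γ.A)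
    (k : Γ.K) (μ : ℝ)
    (h1 : ∀ k', 0 < Tr (MM Γ) a m1 k k' → (L : ℝ) * μ < Hh (MM Γ) Γ.g L (sh m1 a) k')
    (h2 : ∀ k' k'', 0 < Tr (MM Γ) a m1 k k' → 0 < Tr (MM Γ) (sh m1 a) L k' k'' → 0 < Tr (MM Γ) a m1 k k'') :
    ∀ᵐ ω ∂(Γ.envMeasure p1), Γ.state (Γ.blindStrat (pseq m0 m1 L b a)) ω m0 = k →
      μ ≤ atTop.liminf (Γ.avg (Γ.blindStrat (pseq m0 m1 L b a)) ω) := by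
  have := env_prob hp
  have hM := MM_stoch Γ
  set as := pseq m0 m1 L b a with has
  set bb : ℕ → Γ.A := fun i => a (m1 + i % L) with hbb
  have eb : sh (m0 + m1) as = bb := by
    funext i
    simp only [sh, has, pseq, hbb]
    rw [if_neg (by omega), if_neg (by omega), show i + (m0 + m1) - m0 - m1 = i by omega]
  have ebL : ∀ i < L, bb i = sh m1 a i := fun i hi => by
    simp only [hbb, sh]; rw [Nat.mod_eq_of_lt hi, add_comm]
  have ebs : sh L bb = bb := by
    funext i; simp only [sh, hbb, Nat.add_mod_right]
  have ea : ∀ i < m1, sh m0 as i = a i := fun i hi => by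
    simp only [sh, has, pseq]
    rw [if_neg (by omega), if_pos (by omega), Nat.add_sub_cancel]
  rw [← H_congr L bb (sh m1 a) ebL] at h1
  rw [← Tr_congr L bb (sh m1 a) ebL] at h2
  obtain ⟨l, hl, ρ, hρ0, hρ1, hρ⟩ := contraction hM μ L bb (fun k' => 0 < Tr (MM Γ) a m1 k k') h1
  have hiter := Op_iter hM l μ L bb ebs (fun k' => 0 < Tr (MM Γ) a m1 k k') ρ hρ0 hρ (fun k' k'' => h2 k' k'')
  set f : ℕ → Γ.K → ℝ := fun s k' => if s < m0 then 1 else if s = m0 then (if k' = k then 1 else 0) else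
    if s < m0 + m1 then 1 else Real.exp (-l * (Γ.g k' (as s) - μ)) with hf
  have hf0 : ∀ s k', 0 ≤ f s k' := by
    intro s k'; simp only [hf]; split_ifs <;> first | positivity | norm_num
  have hf1 : ∀ s < m0 + m1, ∀ k', f s k' ≤ 1 := by
    intro s hs k'; simp only [hf]; split_ifs <;> norm_num
  have hfe : sh (m0 + m1) f = ef Γ.g l μ bb := by
    funext i k'
    simp only [sh, hf, ef]
    rw [if_neg (by omega), if_neg (by omega), if_neg (by omega), ← eb]; rfl
  have hE : ∀ j, ∫ ω, Pf Γ f (m0 + (m1 + j * L)) (fun _ => 1) (Γ.state (Γ.blindStrat as) ω) ∂(Γ.envMeasure p1) ≤ ρ ^ j := by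
    intro j
    rw [key_formula Γ hp]
    refine hp.dot_le _ _ fun k0 => ?_
    rw [Op_add]
    refine Op_le_const hM m0 f (fun s hs k' => ⟨hf0 s k', hf1 s (by omega) k'⟩) as _ _ (pow_nonneg hρ0 j) (fun k' => ?_) k0
    rw [Op_add, sh_sh, sh_sh, eb, hfe]
    by_cases hk : k' = k
    · subst hk
      refine (Op_mono hM m1 (sh m0 f) (fun s k => hf0 _ _) (sh m0 as) _ (fun _ => ρ ^ j) k' fun k'' hk'' => ?_).trans ?_
      · rw [Tr_congr m1 _ a ea] at hk''
        exact hiter j k'' hk''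
      · exact Op_le_const hM m1 _ (fun s hs k' => ⟨hf0 _ k', hf1 _ (by omega) k'⟩) _ _ _ (pow_nonneg hρ0 j) (fun _ => le_rfl) _
    · obtain ⟨m, rfl⟩ := Nat.exists_eq_add_of_le' hm1
      have : sh m0 f 0 k' = 0 := by simp [sh, hf, hk]
      simp only [Op]
      rw [this, zero_mul]; exact pow_nonneg hρ0 j
  set r := fun (ω : Γ.Env) i => Γ.rew (Γ.blindStrat as) ω i with hr
  set B : ℕ → Set Γ.Env := fun j => {ω | Γ.state (Γ.blindStrat as) ω m0 = k ∧
    ∑ s ∈ Finset.range (j * L), (r ω ((m0 + m1) + s) - μ) ≤ 0} with hB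
  have hPf0 : ∀ n st, 0 ≤ Pf Γ f n (fun _ => 1) st := fun n st =>
    mul_nonneg (Finset.prod_nonneg fun s _ => hf0 _ _) zero_le_one
  have hBsub : ∀ j, B j ⊆ {ω | 1 ≤ Pf Γ f (m0 + (m1 + j * L)) (fun _ => 1) (Γ.state (Γ.blindStrat as) ω)} := by
    rintro j ω ⟨hω1, hω2⟩
    simp only [Set.mem_ofPred_eq, Pf, mul_one]
    rw [← add_assoc, Finset.prod_range_add]
    have e1 : ∏ s ∈ Finset.range (m0 + m1), f s (Γ.state (Γ.blindStrat as) ω s) = 1 := by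
      refine Finset.prod_eq_one fun s hs => ?_
      have hs := Finset.mem_range.1 hs
      simp only [hf]
      split_ifs with h3 h4 h5
      · rfl
      · rfl
      · subst h4; exact absurd hω1 h5
      · rfl
    have e2 : ∏ s ∈ Finset.range (j * L), f (m0 + m1 + s) (Γ.state (Γ.blindStrat as) ω (m0 + m1 + s)) =
        Real.exp (-l * ∑ s ∈ Finset.range (j * L), (r ω ((m0 + m1) + s) - μ)) := by
      rw [Finset.mul_sum, Real.exp_sum]
      refine Finset.prod_congr rfl fun s _ => ?_
      simp only [hf, hr, rew_blind]
      rw [if_neg (by omega), if_neg (by omega), if_neg (by omega)]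
    rw [e1, e2, one_mul]
    refine Real.one_le_exp ?_
    nlinarith
  have hmeas : ∀ j, Γ.envMeasure p1 (B j) ≤ ENNReal.ofReal (ρ ^ j) := by
    intro j
    refine (measure_mono (hBsub j)).trans ?_
    rw [ENNReal.le_ofReal_iff_toReal_le (measure_ne_top _ _) (pow_nonneg hρ0 j)]
    refine le_trans ?_ (hE j)
    obtain ⟨C, hC⟩ := Pf_bound Γ f (m0 + (m1 + j * L)) (fun _ => 1)
    have := mul_meas_ge_le_integral_of_nonneg (μ := Γ.envMeasure p1)
      (f := fun ω => Pf Γ f (m0 + (m1 + j * L)) (fun _ => 1) (Γ.state (Γ.blindStrat as) ω))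
      (Eventually.of_forall fun ω => hPf0 _ _)
      (Integrable.of_bound (Pf_measurable Γ f _ _ _ (state_measurable Γ as)).aestronglyMeasurable C
        (Eventually.of_forall fun u => hC _)) 1
    rw [one_mul] at this
    exact this
  have hsum : ∑' j, Γ.envMeasure p1 (B j) ≠ ⊤ := by
    refine ne_top_of_le_ne_top ?_ (ENNReal.tsum_le_tsum hmeas)
    rw [← ENNReal.ofReal_tsum_of_nonneg (fun j => pow_nonneg hρ0 j) (summable_geometric_of_lt_one hρ0 hρ1)]
    exact ENNReal.ofReal_ne_top
  filter_upwards [ae_eventually_notMem hsum] with ω hω hk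
  have hω' : ∀ᶠ j : ℕ in atTop, 0 < ∑ s ∈ Finset.range (j * L), (r ω ((m0 + m1) + s) - μ) := by
    filter_upwards [hω] with j hj
    by_contra hcon
    exact hj ⟨hk, not_lt.1 hcon⟩
  have h3 := liminf_ge (r ω) (fun i => Γ.g_nonneg _ _) (m0 + m1) L hL μ hω'
  refine le_of_forall_pos_le_add fun δ hδ => ?_
  have := le_liminf_of_le (bdd2 Γ (Γ.blindStrat as) ω) (h3 δ hδ)
  linarith

end lower

end

section
open Matrix Topology ProbabilityTheory

section final
variable (Γ : POMDP)

lemma pay_lower {p1 : Γ.K → ℝ} (hp : IsB p1) (V : ℝ) (x : (Γ.K → ℝ) × (ℕ → Γ.A)) (n : ℕ → ℕ) (hB : IsB x.1)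
    (hin : ∀ i, i < n i)
    (hy : ∀ ε > 0, ∃ y, Reach (MM Γ) p1 y ∧ ∀ k, |y.1 k - x.1 k| < ε)
    (hV : ∀ i, V - 2 / 2 ^ i ≤ Sx (MM Γ) Γ.g (n i) x / n i)
    (hF : ∀ i m, m ≤ i → Fx (MM Γ) Γ.g m (n i) x / (n i : ℝ) ^ 2 ≤ 2 / 2 ^ i)
    (ε : ℝ) (hε : 0 < ε) (hε1 : ε ≤ 1) :
    ∃ as : ℕ → Γ.A, EventuallyPeriodic as ∧ V - 3 * ε ≤ Γ.pay p1 (Γ.blindStrat as) := by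
  have hM := MM_stoch Γ
  have := env_prob hp
  obtain ⟨c, hc, hVc, hCε⟩ := propC hM Γ.g_nonneg Γ.g_le_one V x n hB hin hV hF
  obtain ⟨m1, hm1, L, hL, hb1, hb2⟩ := hCε ε hε
  have hcard : (0:ℝ) < Fintype.card Γ.K := by exact_mod_cast Fintype.card_pos
  obtain ⟨y, ⟨m0, b, rfl⟩, hyx⟩ := hy (ε / (3 * Fintype.card Γ.K)) (by positivity)
  refine ⟨pseq m0 m1 L b x.2, pseq_per m0 m1 L hL b x.2, ?_⟩
  set as := pseq m0 m1 L b x.2 with has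
  set φ : Γ.K → ℝ := fun k => if 0 < x.1 k then c k - 2 * ε else 0 with hφ
  have hL' : (0:ℝ) < L := by exact_mod_cast hL
  have hae : ∀ k, ∀ᵐ ω ∂(Γ.envMeasure p1), Γ.state (Γ.blindStrat as) ω m0 = k →
      φ k ≤ atTop.liminf (Γ.avg (Γ.blindStrat as) ω) := by
    intro k
    by_cases hk : 0 < x.1 k
    · simp only [hφ, if_pos hk]
      refine pseq_ae Γ hp m0 m1 L hm1 hL b x.2 k (c k - 2 * ε) (fun k' hk' => ?_) (fun k' k'' => hb2 k k' k'')
      have := hb1 k k' hk hk'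
      nlinarith
    · simp only [hφ, if_neg hk]
      exact Eventually.of_forall fun ω _ => lim_nonneg Γ _ _
  have hae' : ∀ᵐ ω ∂(Γ.envMeasure p1), φ (Γ.state (Γ.blindStrat as) ω m0) ≤
      atTop.liminf (Γ.avg (Γ.blindStrat as) ω) := by
    filter_upwards [ae_all_iff.2 hae] with ω hω using hω _ rfl
  have h1 : p1 ⬝ᵥ (Tr (MM Γ) as m0 *ᵥ φ) ≤ Γ.pay p1 (Γ.blindStrat as) := by
    rw [← state_integral Γ hp]
    exact integral_mono_ae (state_integrable Γ hp as m0 φ) (lim_integrable Γ hp as) hae'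
  refine le_trans ?_ h1
  have e1 : Tr (MM Γ) as m0 = Tr (MM Γ) b m0 := Tr_congr m0 _ _ fun i hi => by
    simp only [has, pseq]; rw [if_pos hi]
  rw [e1, Matrix.dotProduct_mulVec]
  simp only [th] at hyx
  set y := p1 ᵥ* Tr (MM Γ) b m0
  have hφ3 : ∀ k, |φ k| ≤ 3 := by
    intro k
    have := hc k
    simp only [hφ]
    split_ifs
    · rw [abs_le]; constructor <;> linarith
    · norm_num
  have h2 : ∀ k, x.1 k * c k - 2 * ε * x.1 k - ε / Fintype.card Γ.K ≤ y k * φ k := by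
    intro k
    have e2 : x.1 k * φ k = x.1 k * c k - 2 * ε * x.1 k := by
      by_cases hk : 0 < x.1 k
      · simp only [hφ, if_pos hk]; ring
      · have : x.1 k = 0 := le_antisymm (not_lt.1 hk) (hB.1 k)
        rw [this]; ring
    have h3 : |(y k - x.1 k) * φ k| ≤ ε / (3 * Fintype.card Γ.K) * 3 := by
      rw [abs_mul]
      exact mul_le_mul (hyx k).le (hφ3 k) (abs_nonneg _) (by positivity)
    have h4 := (abs_le.1 h3).1
    have e3 : ε / (3 * Fintype.card Γ.K) * 3 = ε / Fintype.card Γ.K := by field_simp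
    rw [e3] at h4
    linarith
  have h5 := Finset.sum_le_sum (fun k (_ : k ∈ Finset.univ) => h2 k)
  rw [Finset.sum_sub_distrib, Finset.sum_sub_distrib, ← Finset.mul_sum, hB.2, Finset.sum_const, Finset.card_univ,
    nsmul_eq_mul, mul_div_cancel₀ _ hcard.ne'] at h5
  change _ ≤ ∑ k, y k * φ k
  linarith

/-- the unique history -/
def bh (σ : Γ.Strategy) : ℕ → Γ.Hist
  | 0 => []
  | m + 1 => bh σ m ++ [(σ (bh σ m), ⟨0, Γ.hS⟩)]

lemma bh_length (σ : Γ.Strategy) (m : ℕ) : (bh Γ σ m).length = m := by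
  induction m with
  | zero => rfl
  | succ m ih => simp [bh, ih]

lemma blind_hist (hΓ : Γ.Blind) (σ : Γ.Strategy) (ω : Γ.Env) (m : ℕ) : (Γ.traj σ ω m).2 = bh Γ σ m := by
  have hS : ∀ s t : Γ.S, s = t := by
    intro s t
    unfold POMDP.Blind at hΓ
    apply Fin.ext; have := s.2; have := t.2; omega
  induction m with
  | zero => rfl
  | succ m ih =>
    simp only [POMDP.traj, bh, ih]
    congr 3
    exact hS _ _

lemma blind_traj (hΓ : Γ.Blind) (σ : Γ.Strategy) (ω : Γ.Env) (m : ℕ) :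
    Γ.traj (Γ.blindStrat fun m => σ (bh Γ σ m)) ω m = Γ.traj σ ω m := by
  induction m with
  | zero => rfl
  | succ m ih =>
    simp only [POMDP.traj, ih]
    rw [show (Γ.blindStrat fun m => σ (bh Γ σ m)) (Γ.traj σ ω m).2 = σ (Γ.traj σ ω m).2 by
      simp only [POMDP.blindStrat, blind_hist Γ hΓ, bh_length]]

lemma blind_pay (hΓ : Γ.Blind) (p1 : Γ.K → ℝ) (σ : Γ.Strategy) :
    Γ.pay p1 σ = Γ.pay p1 (Γ.blindStrat fun m => σ (bh Γ σ m)) := by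
  unfold POMDP.pay
  have : ∀ ω, Γ.avg σ ω = Γ.avg (Γ.blindStrat fun m => σ (bh Γ σ m)) ω := by
    intro ω
    funext n
    simp only [POMDP.avg, POMDP.rew, POMDP.state, POMDP.act, POMDP.hist, blind_traj Γ hΓ]
    simp only [POMDP.blindStrat, blind_hist Γ hΓ, bh_length]
  simp only [this]

end final

end

/-- In a blind MDP, the value is the supremum of the long-run average payoff over
eventually periodic strategies. -/
theorem val_eq_sSup_eventuallyPeriodic (Γ : POMDP) (hΓ : Γ.Blind)
    (p1 : Γ.K → ℝ) (hp1 : IsBelief p1) :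
    Γ.val p1 =
      sSup {x : ℝ | ∃ as : ℕ → Γ.A, EventuallyPeriodic as ∧
        Γ.pay p1 (Γ.blindStrat as) = x} := by
  have hp : IsB p1 := hp1
  obtain ⟨V, hup, x, n, hB, hin, hy, hV, hF⟩ :=
    exists_limit (MM_stoch Γ) Γ.g_nonneg Γ.g_le_one hp
  have hle : ∀ σ : Γ.Strategy, Γ.pay p1 σ ≤ V := fun σ => by
    rw [blind_pay Γ hΓ]; exact pay_upper Γ hp _ V hup
  have hlow := pay_lower Γ hp V x n hB hin hy hV hF
  have hbdd : BddAbove (Set.range fun σ : Γ.Strategy => Γ.pay p1 σ) := ⟨V, by rintro _ ⟨σ, rfl⟩; exact hle σ⟩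
  have hbdd' : BddAbove {x : ℝ | ∃ as : ℕ → Γ.A, EventuallyPeriodic as ∧
        Γ.pay p1 (Γ.blindStrat as) = x} := ⟨V, by rintro _ ⟨as, _, rfl⟩; exact hle _⟩
  apply le_antisymm
  · have hVs : V ≤ sSup {x : ℝ | ∃ as : ℕ → Γ.A, EventuallyPeriodic as ∧
        Γ.pay p1 (Γ.blindStrat as) = x} := by
      refine le_of_forall_pos_le_add fun η hη => ?_
      obtain ⟨as, has, hpay⟩ := hlow (min (η / 3) 1) (by positivity) (min_le_right _ _)
      have h1 := le_csSup hbdd' ⟨as, has, rfl⟩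
      have h2 := min_le_left (η / 3) 1
      linarith
    exact ciSup_le fun σ => (hle σ).trans hVs
  · obtain ⟨as0, has0, -⟩ := hlow 1 one_pos le_rfl
    refine csSup_le ⟨_, as0, has0, rfl⟩ ?_
    rintro _ ⟨as, _, rfl⟩
    exact le_ciSup hbdd (Γ.blindStrat as)

end PomdpPaper
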